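/- Fix an integer r ≥ 2. Call a finite set A of positive integers r-fork-free if there do not exist an element x ∈ A and r distinct elements y₁, ..., y_r ∈ A \ {x} with x ∣ y_j for all j. Let f_r(n) be the maximum cardinality of an r-fork-free subset of {1, ..., n}. Then there exists a real constant c_r such that for every ε > 0 there is a constant K_ε with |f_r(n) − c_r·n| ≤ K_ε · n · exp(−(1−ε)·√(log n · log log n)) for all n ≥ 3. -/

import Mathlib

open Finset
open scoped Classical

/-- A finite set of positive integers is `r`-fork-free if no element divides `r` other
distinct elements. -/
def RForkFree (r : ℕ) (A : Finset ℕ) : Prop :=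
  ¬∃ x ∈ A, ∃ Y : Finset ℕ, Y ⊆ A.erase x ∧ Y.card = r ∧ ∀ y ∈ Y, x ∣ y

/-- `f_r(n)`: the maximum cardinality of an `r`-fork-free subset of `{1, …, n}`. -/
noncomputable def fFork (r n : ℕ) : ℕ :=
  ((Finset.Icc 1 n).powerset.filter (RForkFree r)).sup Finset.card

/-! ### Maximal fork-free subsets of a finite set -/

lemma RForkFree.mono {r : ℕ} {A B : Finset ℕ} (hB : RForkFree r B) (h : A ⊆ B) :
    RForkFree r A := by
  rintro ⟨x, hx, Y, hY, hc, hd⟩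
  exact hB ⟨x, h hx, Y, hY.trans (erase_subset_erase x h), hc, hd⟩

lemma RForkFree.image_mul {r v : ℕ} (hv : 0 < v) {A : Finset ℕ} (hA : RForkFree r A) :
    RForkFree r (A.image (v * ·)) := by
  rintro ⟨x, hx, Y, hY, hc, hd⟩
  have hinj : Function.Injective (v * · : ℕ → ℕ) := fun a b h => Nat.eq_of_mul_eq_mul_left hv h
  obtain ⟨a, ha, rfl⟩ := mem_image.1 hx
  rw [← image_erase hinj] at hY
  obtain ⟨Z, hZ, rfl⟩ := subset_image_iff.1 hY
  rw [card_image_of_injective _ hinj] at hc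
  refine hA ⟨a, ha, Z, hZ, hc, fun y hy => ?_⟩
  exact (Nat.mul_dvd_mul_iff_left hv).1 (hd _ (mem_image_of_mem _ hy))

lemma RForkFree.of_image_mul {r v : ℕ} (hv : 0 < v) {A : Finset ℕ}
    (hA : RForkFree r (A.image (v * ·))) : RForkFree r A := by
  rintro ⟨x, hx, Y, hY, hc, hd⟩
  have hinj : Function.Injective (v * · : ℕ → ℕ) := fun a b h => Nat.eq_of_mul_eq_mul_left hv h
  refine hA ⟨v * x, mem_image_of_mem _ hx, Y.image (v * ·), ?_, ?_, ?_⟩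
  · rw [← image_erase hinj]
    exact image_subset_image hY
  · rw [card_image_of_injective _ hinj, hc]
  · intro y hy
    obtain ⟨z, hz, rfl⟩ := mem_image.1 hy
    exact mul_dvd_mul_left v (hd z hz)

/-- The maximum cardinality of an `r`-fork-free subset of `X`. -/
noncomputable def maxFork (r : ℕ) (X : Finset ℕ) : ℕ :=
  (X.powerset.filter (RForkFree r)).sup Finset.card

lemma card_le_maxFork {r : ℕ} {A X : Finset ℕ} (hAX : A ⊆ X) (hA : RForkFree r A) :
    A.card ≤ maxFork r X :=
  le_sup (f := Finset.card) (mem_filter.2 ⟨mem_powerset.2 hAX, hA⟩)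

lemma exists_card_eq_maxFork (r : ℕ) (X : Finset ℕ) :
    ∃ A ⊆ X, RForkFree r A ∧ A.card = maxFork r X := by
  have hne : (X.powerset.filter (RForkFree r)).Nonempty :=
    ⟨∅, mem_filter.2 ⟨empty_mem_powerset X, fun ⟨x, hx, _⟩ => by simp at hx⟩⟩
  obtain ⟨A, hA, h⟩ := exists_mem_eq_sup _ hne Finset.card
  rw [mem_filter, mem_powerset] at hA
  exact ⟨A, hA.1, hA.2, h.symm⟩

lemma maxFork_mono {r : ℕ} {X Y : Finset ℕ} (h : X ⊆ Y) : maxFork r X ≤ maxFork r Y := by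
  obtain ⟨A, hA, hf, hc⟩ := exists_card_eq_maxFork r X
  exact hc ▸ card_le_maxFork (hA.trans h) hf

lemma maxFork_le_erase_add_one (r s : ℕ) (X : Finset ℕ) :
    maxFork r X ≤ maxFork r (X.erase s) + 1 := by
  obtain ⟨A, hA, hf, hc⟩ := exists_card_eq_maxFork r X
  have h1 := card_le_maxFork (erase_subset_erase s hA) (hf.mono (erase_subset s A))
  have h2 := pred_card_le_card_erase (s := A) (a := s)
  omega

lemma maxFork_image_mul (r : ℕ) {v : ℕ} (hv : 0 < v) (X : Finset ℕ) :
    maxFork r (X.image (v * ·)) = maxFork r X := by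
  have hinj : Function.Injective (v * · : ℕ → ℕ) := fun a b h => Nat.eq_of_mul_eq_mul_left hv h
  apply le_antisymm
  · obtain ⟨A, hA, hf, hc⟩ := exists_card_eq_maxFork r (X.image (v * ·))
    obtain ⟨B, hB, rfl⟩ := subset_image_iff.1 hA
    rw [← hc, card_image_of_injective _ hinj]
    exact card_le_maxFork hB (hf.of_image_mul hv)
  · obtain ⟨A, hA, hf, hc⟩ := exists_card_eq_maxFork r X
    rw [← hc, ← card_image_of_injective A hinj]
    exact card_le_maxFork (image_subset_image hA) (hf.image_mul hv)

lemma maxFork_union (r : ℕ) {X Y : Finset ℕ} (hd : Disjoint X Y)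
    (hXY : ∀ x ∈ X, ∀ y ∈ Y, ¬x ∣ y ∧ ¬y ∣ x) :
    maxFork r (X ∪ Y) = maxFork r X + maxFork r Y := by
  apply le_antisymm
  · obtain ⟨A, hA, hf, hc⟩ := exists_card_eq_maxFork r (X ∪ Y)
    have h1 := card_le_maxFork (r := r) (A := A ∩ X) inter_subset_right
      (hf.mono inter_subset_left)
    have h2 := card_le_maxFork (r := r) (A := A ∩ Y) inter_subset_right
      (hf.mono inter_subset_left)
    have h3 : A = (A ∩ X) ∪ (A ∩ Y) := by
      rw [← inter_union_distrib_left, inter_eq_left.2 hA]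
    have h4 := card_union_le (A ∩ X) (A ∩ Y)
    rw [← h3] at h4
    omega
  · obtain ⟨A, hA, hfA, hcA⟩ := exists_card_eq_maxFork r X
    obtain ⟨B, hB, hfB, hcB⟩ := exists_card_eq_maxFork r Y
    rw [← hcA, ← hcB, ← card_union_of_disjoint (disjoint_of_subset_left hA
      (disjoint_of_subset_right hB hd))]
    refine card_le_maxFork (union_subset_union hA hB) ?_
    rintro ⟨x, hx, Z, hZ, hc, hdvd⟩
    rcases mem_union.1 hx with hxA | hxB
    · refine hfA ⟨x, hxA, Z, fun y hy => ?_, hc, hdvd⟩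
      have := mem_erase.1 (hZ hy)
      refine mem_erase.2 ⟨this.1, (mem_union.1 this.2).resolve_right fun h => ?_⟩
      exact (hXY x (hA hxA) y (hB h)).1 (hdvd y hy)
    · refine hfB ⟨x, hxB, Z, fun y hy => ?_, hc, hdvd⟩
      have := mem_erase.1 (hZ hy)
      refine mem_erase.2 ⟨this.1, (mem_union.1 this.2).resolve_left fun h => ?_⟩
      exact (hXY y (hA h) x (hB hxB)).2 (hdvd y hy)

/-- The growth of the maximal fork-free cardinality when `s` is adjoined to `(s, n]`. -/
noncomputable def forkInc (r s n : ℕ) : ℝ :=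
  (maxFork r (Icc s n) : ℝ) - maxFork r (Icc (s + 1) n)

lemma Icc_succ_eq_erase (s n : ℕ) : Icc (s + 1) n = (Icc s n).erase s := by
  ext x
  simp only [mem_erase, mem_Icc]
  omega

lemma forkInc_nonneg (r s n : ℕ) : 0 ≤ forkInc r s n := by
  rw [forkInc, sub_nonneg, Icc_succ_eq_erase]
  exact_mod_cast maxFork_mono (erase_subset _ _)

lemma forkInc_le_one (r s n : ℕ) : forkInc r s n ≤ 1 := by
  have := maxFork_le_erase_add_one r s (Icc s n)
  rw [forkInc, sub_le_iff_le_add', Icc_succ_eq_erase]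
  exact_mod_cast this

lemma fFork_eq_sum_forkInc (r n : ℕ) : (fFork r n : ℝ) = ∑ s ∈ Icc 1 n, forkInc r s n := by
  have h := sum_Ico_sub (fun s => -(maxFork r (Icc s n) : ℝ)) (Nat.succ_le_succ (Nat.zero_le n))
  have h0 : maxFork r (Icc (n + 1) n) = 0 := by
    obtain ⟨A, hA, -, hc⟩ := exists_card_eq_maxFork r (Icc (n + 1) n)
    rw [Icc_eq_empty (by omega), subset_empty] at hA
    rw [← hc, hA, card_empty]
  simp only [forkInc, sub_neg_eq_add, neg_add_eq_sub, Nat.succ_eq_add_one, zero_add, h0] at h ⊢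
  rw [show Icc 1 n = Ico 1 (n + 1) from rfl, h, Nat.cast_zero, sub_zero]
  rfl

/-- The increment only depends on the connected component of `u * v` in the divisor graph,
and this component consists of the multiples of `v` by smooth numbers. -/
lemma forkInc_eq_smooth (r n u v : ℕ) (huv : n / (u * v) ≠ 0)
    (hu : u ∈ Nat.smoothNumbers (n / (u * v) + 1))
    (hv : ∀ p, p.Prime → p ∣ v → n / (u * v) < p) :
    forkInc r (u * v) n =
      (maxFork r {w ∈ Icc u (n / v) | w ∈ Nat.smoothNumbers (n / (u * v) + 1)} : ℝ) -
        maxFork r (({w ∈ Icc u (n / v) | w ∈ Nat.smoothNumbers (n / (u * v) + 1)}).erase u) := by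
  set i := n / (u * v) with hi
  have hpos : 0 < u * v := Nat.pos_of_ne_zero fun h => huv (by rw [hi, h, Nat.div_zero])
  have hvpos : 0 < v := Nat.pos_of_mul_pos_left hpos
  have hupos : 0 < u := Nat.pos_of_mul_pos_right hpos
  have hle : u * v ≤ n := by
    by_contra h
    exact huv (Nat.div_eq_of_lt (not_le.1 h))
  have hinj : Function.Injective (v * · : ℕ → ℕ) := fun a b h => Nat.eq_of_mul_eq_mul_left hvpos h
  set W := {w ∈ Icc u (n / v) | w ∈ Nat.smoothNumbers (i + 1)} with hW
  set C := W.image (v * ·) with hC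
  have hCsub : C ⊆ Icc (u * v) n := by
    intro x hx
    obtain ⟨w, hw, rfl⟩ := mem_image.1 hx
    have hw := mem_Icc.1 (mem_filter.1 hw).1
    refine mem_Icc.2 ⟨?_, ?_⟩
    · rw [mul_comm]
      exact Nat.mul_le_mul_left v hw.1
    · rw [mul_comm]
      exact (Nat.le_div_iff_mul_le hvpos).1 hw.2
  have memC : ∀ w, w ∈ Nat.smoothNumbers (i + 1) → v * w ∈ Icc (u * v) n → v * w ∈ C := by
    intro w hw hm
    have hm := mem_Icc.1 hm
    refine mem_image_of_mem _ (mem_filter.2 ⟨mem_Icc.2 ⟨?_, ?_⟩, hw⟩)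
    · rw [mul_comm u] at hm
      exact Nat.le_of_mul_le_mul_left hm.1 hvpos
    · rw [Nat.le_div_iff_mul_le hvpos, mul_comm]
      exact hm.2
  have smallk : ∀ a k, u * v ≤ a → a * k ≤ n → k ≤ i := by
    intro a k ha hk
    rw [hi, Nat.le_div_iff_mul_le hpos, mul_comm]
    exact (Nat.mul_le_mul_right k ha).trans hk
  have hsep : ∀ x ∈ C, ∀ y ∈ Icc (u * v) n \ C, ¬x ∣ y ∧ ¬y ∣ x := by
    intro x hx y hy
    obtain ⟨hyI, hyC⟩ := mem_sdiff.1 hy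
    have hxI := hCsub hx
    obtain ⟨w, hw, rfl⟩ := mem_image.1 hx
    have hwS := (mem_filter.1 hw).2
    refine ⟨?_, ?_⟩
    · rintro ⟨k, rfl⟩
      have hk := smallk _ k (mem_Icc.1 hxI).1 (mem_Icc.1 hyI).2
      have hk0 : 0 < k := Nat.pos_of_ne_zero fun h => by
        subst h
        have := (mem_Icc.1 hyI).1
        simp at this
        omega
      apply hyC
      rw [mul_assoc] at hyI ⊢
      exact memC _ (Nat.mul_mem_smoothNumbers hwS
        (Nat.mem_smoothNumbers_of_lt hk0 (by omega))) hyI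
    · rintro ⟨k, hk⟩
      have hki := smallk _ k (mem_Icc.1 hyI).1 (hk ▸ (mem_Icc.1 hxI).2)
      have hk0 : 0 < k := Nat.pos_of_ne_zero fun h => by
        subst h
        have := (mem_Icc.1 hxI).1
        rw [hk] at this
        omega
      have hcop : v.Coprime k := by
        refine Nat.Coprime.symm (Nat.coprime_of_dvd fun p hp hpk hpv => ?_)
        have := hv p hp hpv
        have := Nat.le_of_dvd hk0 hpk
        omega
      obtain ⟨b, rfl⟩ := hcop.dvd_of_dvd_mul_right (Dvd.intro w hk)
      refine hyC (memC b (Nat.mem_smoothNumbers_of_dvd hwS ⟨k, ?_⟩) hyI)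
      exact Nat.eq_of_mul_eq_mul_left hvpos (by rw [hk, mul_assoc])
  have h1 : Icc (u * v) n = C ∪ (Icc (u * v) n \ C) := (union_sdiff_of_subset hCsub).symm
  have hmem : u * v ∈ C := by
    rw [mul_comm]
    refine memC u hu ?_
    rw [mul_comm v]
    exact left_mem_Icc.2 hle
  have h2 : Icc (u * v + 1) n = C.erase (u * v) ∪ (Icc (u * v) n \ C) := by
    rw [Icc_succ_eq_erase]
    ext x
    have := @hCsub x
    simp only [mem_erase, mem_union, mem_sdiff]
    by_cases hx : x = u * v
    · subst hx; simp [hmem]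
    · tauto
  have h3 : C.erase (u * v) = (W.erase u).image (v * ·) := by
    rw [image_erase hinj, mul_comm u v]
  have e1 := maxFork_union r disjoint_sdiff hsep
  have e2 := maxFork_union r (disjoint_of_subset_left (erase_subset (u * v) C) disjoint_sdiff)
    fun x hx => hsep x (mem_of_mem_erase hx)
  rw [← h1, hC, maxFork_image_mul r hvpos] at e1
  rw [← h2, h3, maxFork_image_mul r hvpos] at e2
  rw [forkInc, e1, e2]
  push_cast
  ring

lemma forkInc_mul (r n u v : ℕ) (huv : n / (u * v) ≠ 0)
    (hu : u ∈ Nat.smoothNumbers (n / (u * v) + 1))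
    (hv : ∀ p, p.Prime → p ∣ v → n / (u * v) < p) :
    forkInc r (u * v) n = forkInc r u (n / v) := by
  have h : n / v / (u * 1) = n / (u * v) := by
    rw [Nat.div_div_eq_div_mul, mul_one, mul_comm]
  have h' := forkInc_eq_smooth r (n / v) u 1 (by rwa [h]) (by rwa [h])
    (fun p hp hp1 => absurd (Nat.dvd_one.1 hp1) hp.ne_one)
  rw [forkInc_eq_smooth r n u v huv hu hv]
  rw [h, Nat.div_one, mul_one] at h'
  exact h'.symm

/-! ### Truncated inclusion–exclusion over sets of primes -/

lemma sum_neg_one_pow_card_le_eq (W : Finset ℕ) (k : ℕ) :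
    ∑ t ∈ W.powerset with #t ≤ k, (-1 : ℝ) ^ #t =
      ∑ j ∈ range (k + 1), (-1 : ℝ) ^ j * (#W).choose j := by
  rw [← sum_fiberwise_of_maps_to (s := W.powerset.filter fun t => #t ≤ k) (t := range (k + 1))
    (g := fun t => #t) (fun t ht => mem_range.2 (Nat.lt_succ_of_le (mem_filter.1 ht).2))]
  refine sum_congr rfl fun j hj => ?_
  have hset : ((W.powerset.filter fun t => #t ≤ k).filter fun t => #t = j) = powersetCard j W := by
    ext t
    have := mem_range.1 hj
    simp only [mem_filter, mem_powerset, mem_powersetCard]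
    constructor
    · rintro ⟨⟨h1, -⟩, h2⟩
      exact ⟨h1, h2⟩
    · rintro ⟨h1, h2⟩
      exact ⟨⟨h1, by omega⟩, h2⟩
  rw [hset, sum_congr rfl fun t ht => by rw [(mem_powersetCard.1 ht).2], sum_const,
    card_powersetCard, nsmul_eq_mul, mul_comm]

lemma abs_sum_neg_one_pow_card_sub_le (W : Finset ℕ) (k : ℕ) :
    |(if W = ∅ then 1 else 0) - ∑ t ∈ W.powerset with #t ≤ k, (-1 : ℝ) ^ #t| ≤
      #(powersetCard (k + 1) W) := by
  rw [sum_neg_one_pow_card_le_eq, card_powersetCard]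
  rcases hw : #W with _ | w
  · rw [card_eq_zero] at hw
    simp [sum_range_succ', hw]
  · have hne : W ≠ ∅ := fun h => by simp [h] at hw
    have h := congrArg (Int.cast : ℤ → ℝ) (Int.alternating_sum_range_choose_eq_choose (n := w)
      (m := k))
    push_cast at h
    rw [h, if_neg hne, zero_sub, abs_neg, abs_mul, abs_pow, abs_neg, abs_one, one_pow, one_mul,
      Nat.abs_cast, Nat.choose_succ_succ]
    exact_mod_cast Nat.le_add_right _ _

lemma sum_inv_prod_card_gt_le {P : Finset ℕ} {z : ℝ} (hz : 1 ≤ z) (k : ℕ) :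
    ∑ t ∈ P.powerset with k < #t, (∏ p ∈ t, (p : ℝ))⁻¹ ≤
      (z ^ (k + 1))⁻¹ * Real.exp (z * ∑ p ∈ P, (p : ℝ)⁻¹) := by
  have hz0 : 0 < z := by linarith
  rw [le_inv_mul_iff₀ (by positivity), mul_sum]
  calc ∑ t ∈ P.powerset with k < #t, z ^ (k + 1) * (∏ p ∈ t, (p : ℝ))⁻¹
      ≤ ∑ t ∈ P.powerset with k < #t, ∏ p ∈ t, (z * (p : ℝ)⁻¹) := by
        refine sum_le_sum fun t ht => ?_
        rw [prod_mul_distrib, prod_const, prod_inv_distrib]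
        have := (mem_filter.1 ht).2
        gcongr
        omega
    _ ≤ ∑ t ∈ P.powerset, ∏ p ∈ t, (z * (p : ℝ)⁻¹) :=
        sum_le_sum_of_subset_of_nonneg (filter_subset _ _)
          fun t _ _ => prod_nonneg fun p _ => by positivity
    _ = ∏ p ∈ P, (1 + z * (p : ℝ)⁻¹) := (prod_one_add P).symm
    _ ≤ _ := by
        rw [mul_sum, Real.exp_sum]
        refine prod_le_prod (fun p _ => by positivity) fun p _ => ?_
        rw [add_comm]
        exact Real.add_one_le_exp _

lemma sum_neg_one_pow_div_prod (P : Finset ℕ) :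
    ∑ t ∈ P.powerset, (-1 : ℝ) ^ #t * (∏ p ∈ t, (p : ℝ))⁻¹ = ∏ p ∈ P, (1 - (p : ℝ)⁻¹) := by
  simp_rw [sub_eq_add_neg]
  rw [prod_one_add]
  refine sum_congr rfl fun t _ => ?_
  rw [prod_neg, prod_inv_distrib]

lemma card_filter_card_le_le {P : Finset ℕ} {q : ℕ} (hP : ∀ p ∈ P, p.Prime ∧ p ≤ q) (hq : 0 < q)
    (k : ℕ) : #{t ∈ P.powerset | #t ≤ k} ≤ q ^ k := by
  have hmaps : ∀ t ∈ ({t ∈ P.powerset | #t ≤ k} : Finset (Finset ℕ)),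
      ∏ p ∈ t, p ∈ Icc 1 (q ^ k) := by
    intro t ht
    obtain ⟨h1, h2⟩ := mem_filter.1 ht
    rw [mem_powerset] at h1
    refine mem_Icc.2 ⟨prod_pos fun p hp => (hP p (h1 hp)).1.pos, ?_⟩
    exact (prod_le_pow_card t _ q fun p hp => (hP p (h1 hp)).2).trans
      (Nat.pow_le_pow_right hq h2)
  have hinj : Set.InjOn (fun t : Finset ℕ => ∏ p ∈ t, p)
      ({t ∈ P.powerset | #t ≤ k} : Finset (Finset ℕ)) := by
    intro s hs t ht h
    have hs := mem_powerset.1 (mem_filter.1 (mem_coe.1 hs)).1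
    have ht := mem_powerset.1 (mem_filter.1 (mem_coe.1 ht)).1
    rw [← Nat.primeFactors_prod fun p hp => (hP p (hs hp)).1,
      ← Nat.primeFactors_prod fun p hp => (hP p (ht hp)).1]
    exact congrArg _ h
  simpa using card_le_card_of_injOn _ hmaps hinj

/-! ### Integers `s` with a prescribed value of `M / s` -/

/-- The integers `s` with `M / s = i`. -/
def quotFiber (M i : ℕ) : Finset ℕ := Ioc (M / (i + 1)) (M / i)

lemma mem_quotFiber {M i s : ℕ} (hi : 0 < i) : s ∈ quotFiber M i ↔ M / s = i := by
  rw [quotFiber, mem_Ioc]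
  rcases Nat.eq_zero_or_pos s with rfl | hs
  · simp [hi.ne]
  · rw [Nat.div_lt_iff_lt_mul (by omega), Nat.le_div_iff_mul_le hi, Nat.div_eq_iff hs]
    constructor
    · rintro ⟨h1, h2⟩
      rw [mul_comm, add_mul, one_mul] at h1
      rw [mul_comm] at h2
      omega
    · rintro ⟨h1, h2⟩
      have : M < i * s + s := by omega
      constructor <;> nlinarith

lemma pos_of_mem_quotFiber {M i s : ℕ} (hs : s ∈ quotFiber M i) : 0 < s :=
  lt_of_le_of_lt (Nat.zero_le _) (mem_Ioc.1 hs).1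

lemma filter_dvd_quotFiber {M i : ℕ} (hi : 0 < i) (e : ℕ) :
    {s ∈ quotFiber M i | e ∣ s} = (quotFiber (M / e) i).image (e * ·) := by
  ext s
  simp only [mem_filter, mem_image]
  constructor
  · rintro ⟨hs, w, rfl⟩
    refine ⟨w, ?_, rfl⟩
    rw [mem_quotFiber hi] at hs ⊢
    rw [Nat.div_div_eq_div_mul, hs]
  · rintro ⟨w, hw, rfl⟩
    refine ⟨?_, dvd_mul_right e w⟩
    rw [mem_quotFiber hi] at hw ⊢
    rw [← hw, Nat.div_div_eq_div_mul]

lemma sum_filter_dvd_quotFiber {M i e : ℕ} (hi : 0 < i) (he : 0 < e) (f : ℕ → ℝ) :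
    ∑ s ∈ quotFiber M i with e ∣ s, f s = ∑ w ∈ quotFiber (M / e) i, f (e * w) := by
  rw [filter_dvd_quotFiber hi e, sum_image]
  exact fun a _ b _ h => Nat.eq_of_mul_eq_mul_left he h

lemma card_filter_dvd_quotFiber {M i e : ℕ} (hi : 0 < i) (he : 0 < e) :
    #{s ∈ quotFiber M i | e ∣ s} = #(quotFiber (M / e) i) := by
  rw [filter_dvd_quotFiber hi e, card_image_of_injective]
  exact fun a b h => Nat.eq_of_mul_eq_mul_left he h

lemma abs_card_quotFiber_sub_le (n d : ℕ) {N : ℕ} (hN : 0 < N) :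
    |(#(quotFiber (n / d) N) : ℝ) - n / d * (1 / (N * (N + 1)))| ≤ 1 := by
  have hfl : ∀ a : ℕ, ((n / d / a : ℕ) : ℝ) ≤ (n : ℝ) / d / a ∧
      (n : ℝ) / d / a < ((n / d / a : ℕ) : ℝ) + 1 := by
    intro a
    rw [Nat.div_div_eq_div_mul, div_div, ← Nat.cast_mul, ← Nat.floor_div_eq_div (K := ℝ)]
    exact ⟨Nat.floor_le (by positivity), Nat.lt_floor_add_one _⟩
  have h1 := hfl N
  have h2 := hfl (N + 1)
  have h3 : (n : ℝ) / d * (1 / (N * (N + 1))) = (n : ℝ) / d / N - (n : ℝ) / d / (N + 1 : ℕ) := by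
    have : (N : ℝ) ≠ 0 := by positivity
    have : (N : ℝ) + 1 ≠ 0 := by positivity
    push_cast
    generalize (n : ℝ) / d = x
    field_simp
    ring
  rw [quotFiber, Nat.card_Ioc, Nat.cast_sub (Nat.div_le_div_left (by omega) hN), h3, abs_le]
  constructor <;> linarith [h1.1, h1.2, h2.1, h2.2]

/-- The sum of `g N / (N (N + 1))` over all `N` with `N / u = i`. -/
noncomputable def fiberWeight (g : ℕ → ℝ) (i u : ℕ) : ℝ :=
  ∑ N ∈ Ico (i * u) ((i + 1) * u), g N * (1 / (N * (N + 1)))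

lemma fiberWeight_nonneg {g : ℕ → ℝ} (hg : ∀ N, 0 ≤ g N) (i u : ℕ) : 0 ≤ fiberWeight g i u :=
  sum_nonneg fun N _ => mul_nonneg (hg N) (by positivity)

lemma fiberWeight_le {g : ℕ → ℝ} (hg : ∀ N, g N ≤ 1) {i u : ℕ} (hi : 0 < i) (hu : 0 < u) :
    fiberWeight g i u ≤ 1 / (i * (i + 1)) * (u : ℝ)⁻¹ := by
  have hiu : 0 < i * u := Nat.mul_pos hi hu
  calc fiberWeight g i u
      ≤ ∑ N ∈ Ico (i * u) ((i + 1) * u), ((-((N + 1 : ℕ) : ℝ)⁻¹) - (-(N : ℝ)⁻¹)) := by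
        refine sum_le_sum fun N hN => ?_
        have hN0 : 0 < N := hiu.trans_le (mem_Ico.1 hN).1
        have : (N : ℝ) ≠ 0 := by positivity
        have : (N : ℝ) + 1 ≠ 0 := by positivity
        have h1 : (-((N + 1 : ℕ) : ℝ)⁻¹) - (-(N : ℝ)⁻¹) = 1 / (N * (N + 1)) := by
          push_cast
          field_simp
          ring
        rw [h1]
        exact mul_le_of_le_one_left (by positivity) (hg N)
    _ = _ := by
        rw [sum_Ico_sub (fun N : ℕ => -(N : ℝ)⁻¹) (Nat.mul_le_mul_right u (Nat.le_succ i))]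
        have : (i : ℝ) ≠ 0 := by positivity
        have : (u : ℝ) ≠ 0 := by positivity
        have : (i : ℝ) + 1 ≠ 0 := by positivity
        push_cast
        field_simp
        ring

lemma abs_sum_quotFiber_sub_le {g : ℕ → ℝ} (hg0 : ∀ N, 0 ≤ g N) (hg1 : ∀ N, g N ≤ 1)
    (n d : ℕ) {i u : ℕ} (hi : 0 < i) (hu : 0 < u) :
    |∑ w ∈ quotFiber (n / d / u) i, g (n / d / w) - n / d * fiberWeight g i u| ≤ u := by
  have hmaps : ∀ w ∈ quotFiber (n / d / u) i, n / d / w ∈ Ico (i * u) ((i + 1) * u) := by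
    intro w hw
    rw [mem_quotFiber hi, Nat.div_div_eq_div_mul, mul_comm, ← Nat.div_div_eq_div_mul,
      Nat.div_eq_iff hu] at hw
    rw [mem_Ico, add_mul, one_mul]
    omega
  have hfib : ∀ N ∈ Ico (i * u) ((i + 1) * u),
      ({w ∈ quotFiber (n / d / u) i | n / d / w = N} : Finset ℕ) = quotFiber (n / d) N := by
    intro N hN
    rw [mem_Ico] at hN
    have hN0 : 0 < N := (Nat.mul_pos hi hu).trans_le hN.1
    ext w
    rw [mem_filter, mem_quotFiber hN0, and_iff_right_iff_imp]
    intro h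
    rw [mem_quotFiber hi, Nat.div_div_eq_div_mul, mul_comm, ← Nat.div_div_eq_div_mul, h,
      Nat.div_eq_iff hu]
    rw [add_mul, one_mul] at hN
    omega
  rw [← sum_fiberwise_of_maps_to hmaps, fiberWeight, mul_sum, ← sum_sub_distrib]
  calc _ ≤ ∑ N ∈ Ico (i * u) ((i + 1) * u), (1 : ℝ) := by
        refine (abs_sum_le_sum_abs _ _).trans (sum_le_sum fun N hN => ?_)
        have hN0 : 0 < N := (Nat.mul_pos hi hu).trans_le (mem_Ico.1 hN).1
        rw [sum_congr rfl fun w hw => by rw [(mem_filter.1 hw).2], hfib N hN, sum_const,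
          nsmul_eq_mul, mul_left_comm, mul_comm _ (g N), ← mul_sub, abs_mul, abs_of_nonneg (hg0 N)]
        exact mul_le_one₀ (hg1 N) (abs_nonneg _) (abs_card_quotFiber_sub_le n d hN0)
    _ = u := by
        rw [sum_const, Nat.card_Ico, nsmul_eq_mul, mul_one, add_mul, one_mul,
          Nat.add_sub_cancel_left]

/-! ### Sums over smooth numbers -/

/-- The sum of the reciprocals of the primes below `q`. -/
noncomputable def primeRecipSum (q : ℕ) : ℝ := ∑ p ∈ q.primesBelow, (p : ℝ)⁻¹

lemma primeRecipSum_nonneg (q : ℕ) : 0 ≤ primeRecipSum q :=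
  sum_nonneg fun p _ => by positivity

/-- The completely multiplicative function `m ↦ m ^ (-a)`. -/
noncomputable def rpowNegHom (a : ℝ) : ℕ →* ℝ where
  toFun m := (m : ℝ) ^ (-a)
  map_one' := by simp
  map_mul' m n := by
    push_cast
    exact Real.mul_rpow (by positivity) (by positivity)

lemma hasSum_smooth_rpow_neg {a : ℝ} (ha : 0 < a) (q : ℕ) :
    HasSum (fun m : q.smoothNumbers => (m : ℝ) ^ (-a))
      (∏ p ∈ q.primesBelow, (1 - (p : ℝ) ^ (-a))⁻¹) := by
  refine (EulerProduct.summable_and_hasSum_smoothNumbers_prod_primesBelow_geometric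
    (f := rpowNegHom a) (fun {p} hp => ?_) q).2
  change ‖(p : ℝ) ^ (-a)‖ < 1
  rw [Real.norm_of_nonneg (by positivity)]
  exact Real.rpow_lt_one_of_one_lt_of_neg (by exact_mod_cast hp.one_lt) (by linarith)

lemma inv_one_sub_le_exp {x : ℝ} (h0 : 0 ≤ x) (h : x ≤ 2 / 3) :
    (1 - x)⁻¹ ≤ Real.exp (3 * x) := by
  refine le_trans ?_ (Real.add_one_le_exp (3 * x))
  rw [inv_le_comm₀ (by linarith) (by linarith), inv_le_iff_one_le_mul₀ (by linarith)]
  nlinarith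

lemma prod_smooth_le {q : ℕ} {δ : ℝ} (h0 : 0 ≤ δ) (h1 : δ ≤ 1 / 4) :
    ∏ p ∈ q.primesBelow, (1 - (p : ℝ) ^ (-(1 - δ)))⁻¹ ≤
      Real.exp (3 * (q : ℝ) ^ δ * primeRecipSum q) := by
  rw [primeRecipSum, mul_sum, Real.exp_sum]
  have key : ∀ p ∈ q.primesBelow, 0 ≤ (p : ℝ) ^ (-(1 - δ)) ∧ (p : ℝ) ^ (-(1 - δ)) ≤ 2 / 3 ∧
      (p : ℝ) ^ (-(1 - δ)) ≤ (q : ℝ) ^ δ * (p : ℝ)⁻¹ := by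
    intro p hp
    have hpp := Nat.prime_of_mem_primesBelow hp
    have hpq := (Nat.lt_of_mem_primesBelow hp).le
    have hp2 : (2 : ℝ) ≤ p := by exact_mod_cast hpp.two_le
    refine ⟨by positivity, ?_, ?_⟩
    · calc (p : ℝ) ^ (-(1 - δ)) ≤ (2 : ℝ) ^ (-(1 - δ)) :=
            Real.rpow_le_rpow_of_nonpos (by norm_num) hp2 (by linarith)
        _ ≤ (2 : ℝ) ^ (-(3 / 4) : ℝ) :=
            Real.rpow_le_rpow_of_exponent_le (by norm_num) (by linarith)
        _ ≤ 2 / 3 := by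
            rw [← pow_le_pow_iff_left₀ (by positivity) (by norm_num) (n := 4) (by norm_num),
              ← Real.rpow_natCast, ← Real.rpow_mul (by norm_num),
              show (-(3 / 4) * (4 : ℕ) : ℝ) = (-3 : ℤ) by norm_num, Real.rpow_intCast]
            norm_num
    · rw [show -(1 - δ) = δ + -1 by ring, Real.rpow_add (by linarith), Real.rpow_neg_one]
      gcongr
  refine prod_le_prod (fun p hp => ?_) fun p hp => ?_
  · have := key p hp
    exact inv_nonneg.2 (by linarith)
  · have := key p hp
    refine (inv_one_sub_le_exp this.1 this.2.1).trans ?_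
    rw [mul_assoc]
    gcongr
    exact this.2.2

lemma sum_smooth_rpow_le {q : ℕ} {δ : ℝ} (h0 : 0 ≤ δ) (h1 : δ ≤ 1 / 4) {F : Finset ℕ}
    (hF : ∀ u ∈ F, u ∈ q.smoothNumbers) :
    ∑ u ∈ F, (u : ℝ) ^ (-(1 - δ)) ≤ Real.exp (3 * (q : ℝ) ^ δ * primeRecipSum q) := by
  have hs := hasSum_smooth_rpow_neg (a := 1 - δ) (by linarith) q
  rw [← sum_subtype_of_mem (fun u : ℕ => (u : ℝ) ^ (-(1 - δ))) hF]
  exact (sum_le_hasSum _ (fun u _ => by positivity) hs).trans (prod_smooth_le h0 h1)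

lemma sum_smooth_inv_le {q T : ℕ} {δ : ℝ} (hT : 0 < T) (h0 : 0 ≤ δ) (h1 : δ ≤ 1 / 4)
    {F : Finset ℕ} (hF : ∀ u ∈ F, u ∈ q.smoothNumbers ∧ T ≤ u) :
    ∑ u ∈ F, (u : ℝ)⁻¹ ≤ (T : ℝ) ^ (-δ) * Real.exp (3 * (q : ℝ) ^ δ * primeRecipSum q) := by
  refine le_trans ?_ (mul_le_mul_of_nonneg_left
    (sum_smooth_rpow_le h0 h1 fun u hu => (hF u hu).1) (by positivity))
  rw [mul_sum]
  refine sum_le_sum fun u hu => ?_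
  have hTu := (hF u hu).2
  have hu0 : 0 < u := hT.trans_le hTu
  have : (u : ℝ)⁻¹ = (u : ℝ) ^ (-δ) * (u : ℝ) ^ (-(1 - δ)) := by
    rw [← Real.rpow_add (by positivity), ← Real.rpow_neg_one]
    congr 1
    ring
  rw [this]
  refine mul_le_mul_of_nonneg_right ?_ (by positivity)
  exact Real.rpow_le_rpow_of_nonpos (by positivity) (by exact_mod_cast hTu) (by linarith)

lemma exists_smooth_divisor {q T m : ℕ} (hq : 0 < q) (hm : m ∈ q.smoothNumbers) (hT : T < m) :
    ∃ e, e ∣ m ∧ e ∈ q.smoothNumbers ∧ T < e ∧ e ≤ (T + 1) * q := by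
  induction m using Nat.strong_induction_on with
  | _ m ih =>
  by_cases hle : m ≤ (T + 1) * q
  · exact ⟨m, dvd_rfl, hm, hT, hle⟩
  · have hm1 : m ≠ 1 := by
      rintro rfl
      exact hle (Nat.succ_le_of_lt (Nat.mul_pos (Nat.succ_pos T) hq))
    obtain ⟨p, hp, k, rfl⟩ := Nat.exists_prime_and_dvd hm1
    have hpq : p < q := Nat.mem_smoothNumbers'.1 hm p hp (dvd_mul_right p k)
    have hk : k ∈ q.smoothNumbers := Nat.mem_smoothNumbers_of_dvd hm (dvd_mul_left k p)
    have hTk : T < k := by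
      by_contra h
      apply hle
      rw [mul_comm p]
      exact Nat.mul_le_mul (by omega) hpq.le
    have hk0 : 0 < k := by omega
    obtain ⟨e, he, h⟩ := ih k (by nlinarith [hp.two_le]) hk hTk
    exact ⟨e, he.mul_left p, h⟩

/-! ### Factorization into a smooth and a rough part -/

/-- The largest divisor of `s` all of whose prime factors are less than `q`. -/
def smoothPart (q s : ℕ) : ℕ := (s.primeFactorsList.filter (· < q)).prod

lemma smoothPart_mem (q s : ℕ) : smoothPart q s ∈ q.smoothNumbers := Nat.prod_mem_smoothNumbers s q

lemma exists_smoothPart_mul (q : ℕ) {s : ℕ} (hs : s ≠ 0) :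
    ∃ v, s = smoothPart q s * v ∧ ∀ p, p.Prime → p ∣ v → q ≤ p := by
  refine ⟨(s.primeFactorsList.filter (fun p => ¬ p < q)).prod, ?_, fun p hp hpv => ?_⟩
  · have h := List.prod_map_filter_mul_prod_map_filter_not (· < q) (fun p : ℕ => p)
      s.primeFactorsList
    simp only [List.map_id'] at h
    rw [smoothPart, h, Nat.prod_primeFactorsList hs]
  · obtain ⟨a, ha, hpa⟩ := (Prime.dvd_prod_iff hp.prime).1 hpv
    rw [List.mem_filter] at ha
    have := (Nat.prime_dvd_prime_iff_eq hp (Nat.prime_of_mem_primeFactorsList ha.1)).1 hpa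
    simp_all

lemma dvd_of_smooth_mul_eq {q u v u' v' : ℕ} (hu : u ∈ q.smoothNumbers)
    (hv' : ∀ p, p.Prime → p ∣ v' → q ≤ p) (h : u * v = u' * v') : u ∣ u' := by
  have hcop : u.Coprime v' := by
    refine Nat.coprime_of_dvd fun p hp hpu hpv => ?_
    have := hv' p hp hpv
    have := Nat.mem_smoothNumbers'.1 hu p hp hpu
    omega
  exact hcop.dvd_of_dvd_mul_right (Dvd.intro v h)

lemma smoothPart_mul {q u v : ℕ} (hu : u ∈ q.smoothNumbers) (hv0 : v ≠ 0)
    (hv : ∀ p, p.Prime → p ∣ v → q ≤ p) : smoothPart q (u * v) = u := by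
  obtain ⟨w, hw, hr⟩ := exists_smoothPart_mul q (mul_ne_zero hu.1 hv0)
  exact Nat.dvd_antisymm (dvd_of_smooth_mul_eq (smoothPart_mem q _) hv hw.symm)
    (dvd_of_smooth_mul_eq hu hr hw)

/-! ### Counting with a smooth part and a sieved rough part -/

lemma subset_filter_dvd_iff {P t : Finset ℕ} (hP : ∀ p ∈ P, p.Prime) (v : ℕ) :
    t ⊆ P.filter (· ∣ v) ↔ t ⊆ P ∧ ∏ p ∈ t, p ∣ v := by
  constructor
  · intro h
    have ht : t ⊆ P := h.trans (filter_subset _ _)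
    exact ⟨ht, prod_primes_dvd v (fun p hp => (hP p (ht hp)).prime)
      fun p hp => (mem_filter.1 (h hp)).2⟩
  · rintro ⟨h1, h2⟩ p hp
    exact mem_filter.2 ⟨h1 hp, (dvd_prod_of_mem _ hp).trans h2⟩

lemma abs_sum_rough_sub_le {P : Finset ℕ} (hP : ∀ p ∈ P, p.Prime) {g : ℕ → ℝ}
    (hg0 : ∀ N, 0 ≤ g N) (hg1 : ∀ N, g N ≤ 1) (n k : ℕ) {i u : ℕ} (hi : 0 < i) (hu : 0 < u) :
    |∑ v ∈ quotFiber (n / u) i with P.filter (· ∣ v) = ∅, g (n / v) -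
        n * ((∏ p ∈ P, (1 - (p : ℝ)⁻¹)) * fiberWeight g i u)| ≤
      2 * (n * (1 / (i * (i + 1)) * (u : ℝ)⁻¹) *
        ∑ t ∈ P.powerset with k < #t, (∏ p ∈ t, (p : ℝ))⁻¹) +
        u * #{t ∈ P.powerset | #t ≤ k + 1} := by
  set J := quotFiber (n / u) i with hJ
  set A := P.powerset.filter (fun t => #t ≤ k) with hA
  set B := P.powerset.filter (fun t => k < #t) with hB
  set R := ∑ t ∈ B, (∏ p ∈ t, (p : ℝ))⁻¹ with hR
  set w := fiberWeight g i u with hw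
  set X : Finset ℕ → ℝ := fun t => ∑ v ∈ J with ∏ p ∈ t, p ∣ v, g (n / v) with hX
  have hpos : ∀ t ∈ P.powerset, 0 < ∏ p ∈ t, p := fun t ht =>
    prod_pos fun p hp => (hP p (mem_powerset.1 ht hp)).pos
  have hXt : ∀ t ∈ P.powerset, |X t - n * (w * (∏ p ∈ t, (p : ℝ))⁻¹)| ≤ u := by
    intro t ht
    have h := abs_sum_quotFiber_sub_le hg0 hg1 n (∏ p ∈ t, p) hi hu
    have e1 : X t = ∑ w ∈ quotFiber (n / (∏ p ∈ t, p) / u) i, g (n / (∏ p ∈ t, p) / w) := by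
      simp only [hX]
      rw [sum_filter_dvd_quotFiber hi (hpos t ht), Nat.div_div_eq_div_mul, mul_comm u,
        ← Nat.div_div_eq_div_mul]
      exact sum_congr rfl fun w _ => by rw [Nat.div_div_eq_div_mul]
    rw [e1]
    convert h using 3
    push_cast
    rw [div_eq_mul_inv, hw]
    ring
  have hcard : ∀ t ∈ P.powerset, (#{v ∈ J | ∏ p ∈ t, p ∣ v} : ℝ) ≤
      n * (1 / (i * (i + 1)) * (u : ℝ)⁻¹) * (∏ p ∈ t, (p : ℝ))⁻¹ + 1 := by
    intro t ht
    rw [hJ, card_filter_dvd_quotFiber hi (hpos t ht), Nat.div_div_eq_div_mul]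
    have h := (abs_le.1 (abs_card_quotFiber_sub_le n (u * ∏ p ∈ t, p) hi)).2
    have e : (n : ℝ) / (u * ∏ p ∈ t, p : ℕ) * (1 / (i * (i + 1))) =
        n * (1 / (i * (i + 1)) * (u : ℝ)⁻¹) * (∏ p ∈ t, (p : ℝ))⁻¹ := by
      push_cast
      rw [div_eq_mul_inv, mul_inv]
      ring
    linarith
  have hfilt : ∀ v, (P.filter (· ∣ v)).powerset.filter (fun t => #t ≤ k) =
      A.filter (fun t => ∏ p ∈ t, p ∣ v) := by
    intro v
    ext t
    simp only [hA, mem_filter, mem_powerset, subset_filter_dvd_iff hP]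
    tauto
  have hfilt2 : ∀ v, powersetCard (k + 1) (P.filter (· ∣ v)) =
      (powersetCard (k + 1) P).filter (fun t => ∏ p ∈ t, p ∣ v) := by
    intro v
    ext t
    simp only [mem_filter, mem_powersetCard, subset_filter_dvd_iff hP]
    tauto
  have hswap : ∑ v ∈ J, (∑ t ∈ (P.filter (· ∣ v)).powerset with #t ≤ k, (-1 : ℝ) ^ #t) *
      g (n / v) = ∑ t ∈ A, (-1 : ℝ) ^ #t * X t := by
    simp_rw [hfilt, sum_filter, sum_mul, hX, sum_filter, mul_sum]
    rw [sum_comm]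
    refine sum_congr rfl fun t _ => sum_congr rfl fun v _ => ?_
    split_ifs <;> simp
  have hsieve : |∑ v ∈ J with P.filter (· ∣ v) = ∅, g (n / v) - ∑ t ∈ A, (-1 : ℝ) ^ #t * X t| ≤
      n * (1 / (i * (i + 1)) * (u : ℝ)⁻¹) * R + #(powersetCard (k + 1) P) := by
    rw [← hswap, sum_filter, ← sum_sub_distrib]
    calc _ ≤ ∑ v ∈ J, (#(powersetCard (k + 1) (P.filter (· ∣ v))) : ℝ) := by
          refine (abs_sum_le_sum_abs _ _).trans (sum_le_sum fun v _ => ?_)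
          have h := abs_sum_neg_one_pow_card_sub_le (P.filter (· ∣ v)) k
          have e : (if P.filter (· ∣ v) = ∅ then g (n / v) else 0) =
              (if P.filter (· ∣ v) = ∅ then 1 else 0) * g (n / v) := by
            split_ifs <;> simp
          rw [e, ← sub_mul, abs_mul, abs_of_nonneg (hg0 _)]
          exact (mul_le_of_le_one_right (abs_nonneg _) (hg1 _)).trans h
      _ = ∑ t ∈ powersetCard (k + 1) P, (#{v ∈ J | ∏ p ∈ t, p ∣ v} : ℝ) := by
          simp_rw [hfilt2, card_filter, Nat.cast_sum]
          rw [sum_comm]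
      _ ≤ ∑ t ∈ powersetCard (k + 1) P,
            (n * (1 / (i * (i + 1)) * (u : ℝ)⁻¹) * (∏ p ∈ t, (p : ℝ))⁻¹ + 1) :=
          sum_le_sum fun t ht => hcard t (mem_powerset.2 (mem_powersetCard.1 ht).1)
      _ ≤ _ := by
          rw [sum_add_distrib, ← mul_sum, sum_const, nsmul_eq_mul, mul_one]
          gcongr
          rw [hR]
          refine sum_le_sum_of_subset_of_nonneg (fun t ht => ?_) fun t _ _ => by positivity
          rw [mem_powersetCard] at ht
          exact mem_filter.2 ⟨mem_powerset.2 ht.1, by omega⟩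
  have hround : |∑ t ∈ A, (-1 : ℝ) ^ #t * X t -
      n * w * ∑ t ∈ A, (-1 : ℝ) ^ #t * (∏ p ∈ t, (p : ℝ))⁻¹| ≤ u * #A := by
    rw [mul_sum, ← sum_sub_distrib]
    calc _ ≤ ∑ t ∈ A, (u : ℝ) := by
          refine (abs_sum_le_sum_abs _ _).trans (sum_le_sum fun t ht => ?_)
          have e : (-1 : ℝ) ^ #t * X t - n * w * ((-1 : ℝ) ^ #t * (∏ p ∈ t, (p : ℝ))⁻¹) =
              (-1 : ℝ) ^ #t * (X t - n * (w * (∏ p ∈ t, (p : ℝ))⁻¹)) := by ring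
          rw [e, abs_mul, abs_pow, abs_neg, abs_one, one_pow, one_mul]
          exact hXt t (mem_filter.1 ht).1
      _ = _ := by rw [sum_const, nsmul_eq_mul, mul_comm]
  have hw0 : 0 ≤ w := fiberWeight_nonneg hg0 i u
  have hw1 : w ≤ 1 / (i * (i + 1)) * (u : ℝ)⁻¹ := fiberWeight_le hg1 hi hu
  have hmain : |n * w * ∑ t ∈ A, (-1 : ℝ) ^ #t * (∏ p ∈ t, (p : ℝ))⁻¹ -
      n * ((∏ p ∈ P, (1 - (p : ℝ)⁻¹)) * w)| ≤ n * (1 / (i * (i + 1)) * (u : ℝ)⁻¹) * R := by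
    have hsplit := sum_filter_add_sum_filter_not P.powerset (fun t => #t ≤ k)
      (fun t => (-1 : ℝ) ^ #t * (∏ p ∈ t, (p : ℝ))⁻¹)
    simp only [not_le] at hsplit
    rw [← sum_neg_one_pow_div_prod, ← hsplit]
    have e : ∀ a b : ℝ, n * w * a - n * ((a + b) * w) = -(n * w * b) := fun a b => by ring
    rw [e, abs_neg, abs_mul, abs_of_nonneg (by positivity)]
    gcongr
    refine (abs_sum_le_sum_abs _ _).trans (sum_le_sum fun t _ => ?_)
    rw [abs_mul, abs_pow, abs_neg, abs_one, one_pow, one_mul, abs_of_nonneg (by positivity)]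
  have hcount : #(powersetCard (k + 1) P) + #A = #{t ∈ P.powerset | #t ≤ k + 1} := by
    rw [← card_union_of_disjoint]
    · congr 1
      ext t
      simp only [hA, mem_union, mem_filter, mem_powerset, mem_powersetCard, ← and_or_left]
      exact and_congr_right fun _ => by omega
    · rw [disjoint_left]
      intro t ht ht'
      have := (mem_powersetCard.1 ht).2
      have := (mem_filter.1 ht').2
      omega
  have hu1 : (1 : ℝ) ≤ u := by exact_mod_cast hu
  have hpc : (#(powersetCard (k + 1) P) : ℝ) ≤ u * #(powersetCard (k + 1) P) :=
    le_mul_of_one_le_left (by positivity) hu1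
  rw [← hcount]
  push_cast
  rw [abs_le] at hsieve hround hmain ⊢
  constructor <;> linarith [hsieve.1, hsieve.2, hround.1, hround.2, hmain.1, hmain.2]

lemma primesBelow_filter_dvd_eq_empty_iff {q v : ℕ} :
    q.primesBelow.filter (· ∣ v) = ∅ ↔ ∀ p, p.Prime → p ∣ v → q ≤ p := by
  simp only [filter_eq_empty_iff, Nat.mem_primesBelow]
  constructor
  · intro h p hp hpv
    by_contra hlt
    exact h ⟨not_le.1 hlt, hp⟩ hpv
  · intro h p hp hpv
    exact absurd hp.1 (not_lt.2 (h p hp.2 hpv))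

/-- A weight on pairs `s ≤ n` with values in `[0, 1]` which only depends on the smooth part of `s`
and on the quotient of `n` by the rough part of `s`. -/
structure IsLocalWeight (g : ℕ → ℕ → ℝ) : Prop where
  nonneg : ∀ s n, 0 ≤ g s n
  le_one : ∀ s n, g s n ≤ 1
  mul_eq : ∀ n u v, n / (u * v) ≠ 0 → u ∈ Nat.smoothNumbers (n / (u * v) + 1) →
    (∀ p, p.Prime → p ∣ v → n / (u * v) < p) → g (u * v) n = g u (n / v)

lemma IsLocalWeight.sum_smoothPart_eq {g : ℕ → ℕ → ℝ} (hg : IsLocalWeight g) (n : ℕ) {i u : ℕ}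
    (hi : 0 < i) (hu : u ∈ (i + 1).smoothNumbers) :
    ∑ s ∈ quotFiber n i with smoothPart (i + 1) s = u, g s n =
      ∑ v ∈ quotFiber (n / u) i with (i + 1).primesBelow.filter (· ∣ v) = ∅, g u (n / v) := by
  have hu0 : 0 < u := Nat.pos_of_ne_zero hu.1
  have hset : ({s ∈ quotFiber n i | smoothPart (i + 1) s = u} : Finset ℕ) =
      ({v ∈ quotFiber (n / u) i | (i + 1).primesBelow.filter (· ∣ v) = ∅} : Finset ℕ).image
        (u * ·) := by
    ext s
    simp only [mem_filter, mem_image, primesBelow_filter_dvd_eq_empty_iff]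
    constructor
    · rintro ⟨hs, hsm⟩
      obtain ⟨v, hv, hr⟩ := exists_smoothPart_mul (i + 1) (pos_of_mem_quotFiber hs).ne'
      rw [hsm] at hv
      refine ⟨v, ⟨?_, hr⟩, hv.symm⟩
      rw [mem_quotFiber hi] at hs ⊢
      rw [Nat.div_div_eq_div_mul, ← hv, hs]
    · rintro ⟨v, ⟨hv, hr⟩, rfl⟩
      refine ⟨?_, smoothPart_mul hu (pos_of_mem_quotFiber hv).ne' hr⟩
      rw [mem_quotFiber hi] at hv ⊢
      rw [← hv, Nat.div_div_eq_div_mul]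
  rw [hset, sum_image fun a _ b _ h => Nat.eq_of_mul_eq_mul_left hu0 h]
  refine sum_congr rfl fun v hv => ?_
  rw [mem_filter, mem_quotFiber hi, Nat.div_div_eq_div_mul,
    primesBelow_filter_dvd_eq_empty_iff] at hv
  refine hg.mul_eq n u v ?_ ?_ ?_ <;> rw [hv.1]
  · exact hi.ne'
  · exact hu
  · exact hv.2

lemma card_smoothPart_gt_le (n : ℕ) {i T : ℕ} {δ : ℝ} (hi : 0 < i) (hT : 0 < T) (h0 : 0 ≤ δ)
    (h1 : δ ≤ 1 / 4) :
    (#{s ∈ quotFiber n i | T < smoothPart (i + 1) s} : ℝ) ≤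
      n * (1 / (i * (i + 1))) * ((T : ℝ) ^ (-δ) *
        Real.exp (3 * ((i + 1 : ℕ) : ℝ) ^ δ * primeRecipSum (i + 1))) +
        2 * (((i + 1 : ℕ) : ℝ) * T ^ 2) := by
  set F := (Ioc T ((T + 1) * (i + 1))).filter (· ∈ (i + 1).smoothNumbers) with hF
  have hsub : {s ∈ quotFiber n i | T < smoothPart (i + 1) s} ⊆
      F.biUnion fun e => {s ∈ quotFiber n i | e ∣ s} := by
    intro s hs
    obtain ⟨hs, hTs⟩ := mem_filter.1 hs
    obtain ⟨e, he, hes, hTe, hle⟩ := exists_smooth_divisor (Nat.succ_pos i)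
      (smoothPart_mem (i + 1) s) hTs
    obtain ⟨v, hv, -⟩ := exists_smoothPart_mul (i + 1) (pos_of_mem_quotFiber hs).ne'
    refine mem_biUnion.2 ⟨e, mem_filter.2 ⟨mem_Ioc.2 ⟨hTe, hle⟩, hes⟩, mem_filter.2 ⟨hs, ?_⟩⟩
    exact he.trans (Dvd.intro v hv.symm)
  have hFT : ∀ e ∈ F, e ∈ (i + 1).smoothNumbers ∧ T ≤ e := fun e he =>
    ⟨(mem_filter.1 he).2, (mem_Ioc.1 (mem_filter.1 he).1).1.le⟩
  have hcF : (#F : ℝ) ≤ 2 * (((i + 1 : ℕ) : ℝ) * T ^ 2) := by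
    have h : #F ≤ (T + 1) * (i + 1) := by
      refine (card_filter_le _ _).trans ?_
      rw [Nat.card_Ioc]
      omega
    have h' : (T + 1) * (i + 1) ≤ 2 * ((i + 1) * T ^ 2) := by
      have : T + 1 ≤ 2 * T ^ 2 := by nlinarith
      calc (T + 1) * (i + 1) ≤ 2 * T ^ 2 * (i + 1) := Nat.mul_le_mul_right _ this
        _ = _ := by ring
    exact_mod_cast h.trans h'
  calc (#{s ∈ quotFiber n i | T < smoothPart (i + 1) s} : ℝ)
      ≤ ∑ e ∈ F, (#{s ∈ quotFiber n i | e ∣ s} : ℝ) := by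
        exact_mod_cast (card_le_card hsub).trans card_biUnion_le
    _ ≤ ∑ e ∈ F, (n * (1 / (i * (i + 1))) * (e : ℝ)⁻¹ + 1) := by
        refine sum_le_sum fun e he => ?_
        have he0 : 0 < e := hT.trans_le (hFT e he).2
        rw [card_filter_dvd_quotFiber hi he0]
        have h := (abs_le.1 (abs_card_quotFiber_sub_le n e hi)).2
        rw [div_eq_mul_inv, mul_right_comm] at h
        linarith
    _ ≤ _ := by
        rw [sum_add_distrib, ← mul_sum, sum_const, nsmul_eq_mul, mul_one]
        refine add_le_add (mul_le_mul_of_nonneg_left ?_ (by positivity)) hcF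
        exact sum_smooth_inv_le hT h0 h1 hFT

/-! ### The contribution of a fixed quotient -/

lemma abs_sum_rough_sub_le_rpow {g : ℕ → ℝ} (hg0 : ∀ N, 0 ≤ g N) (hg1 : ∀ N, g N ≤ 1) (n : ℕ)
    {i u T : ℕ} {δ : ℝ} (hi : 0 < i) (hu : 0 < u) (huT : u ≤ T) (h0 : 0 ≤ δ) :
    |∑ v ∈ quotFiber (n / u) i with (i + 1).primesBelow.filter (· ∣ v) = ∅, g (n / v) -
        n * ((∏ p ∈ (i + 1).primesBelow, (1 - (p : ℝ)⁻¹)) * fiberWeight g i u)| ≤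
      (2 * (n * (1 / (i * (i + 1))) * ((T : ℝ) ^ (-δ) *
        Real.exp (((i + 1 : ℕ) : ℝ) ^ δ * primeRecipSum (i + 1)))) +
        ((i + 1 : ℕ) : ℝ) * T ^ 2) * (u : ℝ) ^ (-(1 - δ)) := by
  set q := i + 1 with hq
  set k := Nat.log q (T ^ 2 / u ^ 2) with hk
  have hT : 0 < T := hu.trans_le huT
  have hu2 : 0 < u ^ 2 := by positivity
  have hle : u ^ 2 * q ^ k ≤ T ^ 2 := by
    have h1 : q ^ k ≤ T ^ 2 / u ^ 2 := Nat.pow_log_le_self q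
      (Nat.div_pos (Nat.pow_le_pow_left huT 2) hu2).ne'
    rw [mul_comm]
    exact (Nat.le_div_iff_mul_le hu2).1 h1
  have hlt : T ^ 2 ≤ u ^ 2 * q ^ (k + 1) := by
    have h1 : T ^ 2 / u ^ 2 < q ^ (k + 1) := Nat.lt_pow_succ_log_self (by omega) _
    rw [mul_comm]
    exact ((Nat.div_lt_iff_lt_mul hu2).1 h1).le
  have hP : ∀ p ∈ q.primesBelow, p.Prime := fun p hp => Nat.prime_of_mem_primesBelow hp
  refine (abs_sum_rough_sub_le hP hg0 hg1 n k hi hu).trans ?_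
  have hqR : (1 : ℝ) ≤ (q : ℝ) := by exact_mod_cast Nat.succ_pos i
  have huR : (0 : ℝ) < u := by exact_mod_cast hu
  have hTR : (0 : ℝ) < T := by exact_mod_cast hT
  have hz : (1 : ℝ) ≤ (q : ℝ) ^ (δ / 2) := Real.one_le_rpow hqR (by linarith)
  have hupow : (u : ℝ) ^ (-(1 - δ)) = (u : ℝ)⁻¹ * (u : ℝ) ^ δ := by
    rw [show -(1 - δ) = -1 + δ by ring, Real.rpow_add huR, Real.rpow_neg_one]
  have hu1 : (1 : ℝ) ≤ (u : ℝ) ^ δ := Real.one_le_rpow (by exact_mod_cast hu) h0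
  have hzk : (((q : ℝ) ^ (δ / 2)) ^ (k + 1))⁻¹ ≤ (T : ℝ) ^ (-δ) * (u : ℝ) ^ δ := by
    have h1 : ((T : ℝ) / u) ^ δ ≤ ((q : ℝ) ^ (δ / 2)) ^ (k + 1) := by
      calc ((T : ℝ) / u) ^ δ = (((T : ℝ) / u) ^ 2) ^ (δ / 2) := by
            rw [← Real.rpow_natCast, ← Real.rpow_mul (by positivity)]
            congr 1
            push_cast
            ring
        _ ≤ ((q : ℝ) ^ (k + 1)) ^ (δ / 2) := by
            refine Real.rpow_le_rpow (by positivity) ?_ (by linarith)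
            rw [div_pow, div_le_iff₀ (by positivity), mul_comm]
            exact_mod_cast hlt
        _ = _ := by
            rw [← Real.rpow_natCast, ← Real.rpow_natCast, ← Real.rpow_mul (by positivity),
              ← Real.rpow_mul (by positivity), mul_comm]
    rw [Real.div_rpow hTR.le huR.le] at h1
    calc _ ≤ ((T : ℝ) ^ δ / (u : ℝ) ^ δ)⁻¹ := inv_anti₀ (by positivity) h1
      _ = _ := by rw [inv_div, Real.rpow_neg hTR.le, div_eq_mul_inv, mul_comm]
  have htail : ∑ t ∈ q.primesBelow.powerset with k < #t, (∏ p ∈ t, (p : ℝ))⁻¹ ≤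
      (T : ℝ) ^ (-δ) * (u : ℝ) ^ δ * Real.exp ((q : ℝ) ^ δ * primeRecipSum q) := by
    refine (sum_inv_prod_card_gt_le hz k).trans ?_
    refine mul_le_mul hzk (Real.exp_le_exp.2 ?_) (by positivity) (by positivity)
    refine mul_le_mul_of_nonneg_right ?_ (primeRecipSum_nonneg q)
    exact Real.rpow_le_rpow_of_exponent_le hqR (by linarith)
  have hcount : (u : ℝ) * #{t ∈ q.primesBelow.powerset | #t ≤ k + 1} ≤
      (q : ℝ) * T ^ 2 * (u : ℝ) ^ (-(1 - δ)) := by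
    have h1 : #{t ∈ q.primesBelow.powerset | #t ≤ k + 1} ≤ q ^ (k + 1) :=
      card_filter_card_le_le (fun p hp => ⟨hP p hp, (Nat.lt_of_mem_primesBelow hp).le⟩)
        (Nat.succ_pos i) _
    have h2 : (u : ℝ) ^ 2 * (q : ℝ) ^ k ≤ (T : ℝ) ^ 2 := by exact_mod_cast hle
    calc (u : ℝ) * #{t ∈ q.primesBelow.powerset | #t ≤ k + 1} ≤ u * (q : ℝ) ^ (k + 1) := by
          gcongr
          exact_mod_cast h1
      _ = q * ((u : ℝ) ^ 2 * (q : ℝ) ^ k) * (u : ℝ)⁻¹ := by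
          field_simp
          ring
      _ ≤ q * (T : ℝ) ^ 2 * ((u : ℝ)⁻¹ * (u : ℝ) ^ δ) := by
          refine mul_le_mul (by gcongr) ?_ (by positivity) (by positivity)
          exact le_mul_of_one_le_right (by positivity) hu1
      _ = _ := by rw [hupow]
  calc _ ≤ 2 * (n * (1 / (i * (i + 1)) * (u : ℝ)⁻¹) *
        ((T : ℝ) ^ (-δ) * (u : ℝ) ^ δ * Real.exp ((q : ℝ) ^ δ * primeRecipSum q))) +
        (q : ℝ) * T ^ 2 * (u : ℝ) ^ (-(1 - δ)) := by
        gcongr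
    _ = _ := by
        rw [hupow]
        ring

/-- The asymptotic density of the contribution to `∑ s ≤ n, g s n` of those `s` for which
`n / s` rounds down to `i`. -/
noncomputable def localDensity (g : ℕ → ℕ → ℝ) (i : ℕ) : ℝ :=
  (∏ p ∈ (i + 1).primesBelow, (1 - (p : ℝ)⁻¹)) *
    ∑' u : (i + 1).smoothNumbers, fiberWeight (g u) i u

lemma hasSum_smooth_inv (q : ℕ) :
    HasSum (fun m : q.smoothNumbers => (m : ℝ)⁻¹)
      (∏ p ∈ q.primesBelow, (1 - (p : ℝ)⁻¹))⁻¹ := by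
  have h := hasSum_smooth_rpow_neg one_pos q
  simpa only [Real.rpow_neg_one, prod_inv_distrib] using h

lemma prod_one_sub_inv_pos (q : ℕ) : 0 < ∏ p ∈ q.primesBelow, (1 - (p : ℝ)⁻¹) := by
  refine prod_pos fun p hp => ?_
  have h : (1 : ℝ) < p := by exact_mod_cast (Nat.prime_of_mem_primesBelow hp).one_lt
  exact sub_pos.2 (inv_lt_one_of_one_lt₀ h)

lemma prod_one_sub_inv_le_one (q : ℕ) : ∏ p ∈ q.primesBelow, (1 - (p : ℝ)⁻¹) ≤ 1 := by
  refine prod_le_one (fun p hp => ?_) fun p _ => sub_le_self _ (by positivity)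
  have h : (1 : ℝ) < p := by exact_mod_cast (Nat.prime_of_mem_primesBelow hp).one_lt
  exact (sub_pos.2 (inv_lt_one_of_one_lt₀ h)).le

namespace IsLocalWeight

variable {g : ℕ → ℕ → ℝ} {i : ℕ}

lemma summable_fiberWeight (hg : IsLocalWeight g) (hi : 0 < i) :
    Summable fun u : (i + 1).smoothNumbers => fiberWeight (g u) i u :=
  Summable.of_nonneg_of_le (fun u => fiberWeight_nonneg (hg.nonneg u) i u)
    (fun u => fiberWeight_le (hg.le_one u) hi (Nat.pos_of_ne_zero u.2.1))
    ((hasSum_smooth_inv (i + 1)).summable.mul_left _)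

lemma localDensity_nonneg (hg : IsLocalWeight g) (i : ℕ) : 0 ≤ localDensity g i :=
  mul_nonneg (prod_one_sub_inv_pos _).le
    (tsum_nonneg fun u => fiberWeight_nonneg (hg.nonneg u) i u)

lemma localDensity_le (hg : IsLocalWeight g) (hi : 0 < i) :
    localDensity g i ≤ 1 / (i * (i + 1)) := by
  have h := ((hasSum_smooth_inv (i + 1)).mul_left (1 / ((i : ℝ) * (i + 1))))
  have hle : ∑' u : (i + 1).smoothNumbers, fiberWeight (g u) i u ≤ _ :=
    hasSum_le (fun u : (i + 1).smoothNumbers =>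
      fiberWeight_le (hg.le_one u) hi (Nat.pos_of_ne_zero u.2.1))
      (hg.summable_fiberWeight hi).hasSum h
  have hp := prod_one_sub_inv_pos (i + 1)
  calc localDensity g i ≤ _ := mul_le_mul_of_nonneg_left hle hp.le
    _ = _ := by
        rw [mul_comm, mul_assoc, inv_mul_cancel₀ hp.ne', mul_one]

lemma abs_tsum_sub_sum_fiberWeight_le (hg : IsLocalWeight g) {T : ℕ} {δ : ℝ} (hi : 0 < i)
    (hT : 0 < T) (h0 : 0 ≤ δ) (h1 : δ ≤ 1 / 4) :
    |∑ u ∈ Icc 1 T with u ∈ (i + 1).smoothNumbers, fiberWeight (g u) i u -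
        ∑' u : (i + 1).smoothNumbers, fiberWeight (g u) i u| ≤
      1 / (i * (i + 1)) * ((T : ℝ) ^ (-δ) *
        Real.exp (3 * ((i + 1 : ℕ) : ℝ) ^ δ * primeRecipSum (i + 1))) := by
  set U := (Icc 1 T).filter (· ∈ (i + 1).smoothNumbers) with hU
  have hsum := hg.summable_fiberWeight hi
  have hUm : ∀ u ∈ U, u ∈ (i + 1).smoothNumbers := fun u hu => (mem_filter.1 hu).2
  have hlow : ∑ u ∈ U, fiberWeight (g u) i u ≤
      ∑' u : (i + 1).smoothNumbers, fiberWeight (g u) i u := by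
    rw [← sum_subtype_of_mem (p := (· ∈ (i + 1).smoothNumbers))
      (fun u => fiberWeight (g u) i u) hUm]
    exact hsum.sum_le_tsum _ fun u _ => fiberWeight_nonneg (hg.nonneg u) i u
  rw [abs_sub_comm, abs_of_nonneg (sub_nonneg.2 hlow), sub_le_iff_le_add]
  refine hsum.tsum_le_of_sum_le fun F => ?_
  set F' : Finset ℕ := F.map (Function.Embedding.subtype _) with hF'
  have hFm : ∀ u ∈ F', u ∈ (i + 1).smoothNumbers := fun u hu => by
    obtain ⟨v, -, rfl⟩ := mem_map.1 hu
    exact v.2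
  have hnn : ∀ u, 0 ≤ fiberWeight (g u) i u := fun u => fiberWeight_nonneg (hg.nonneg u) i u
  calc ∑ u ∈ F, fiberWeight (g u) i u = ∑ u ∈ F', fiberWeight (g u) i u := by
        rw [hF', sum_map]
        rfl
    _ ≤ ∑ u ∈ F' \ U ∪ U, fiberWeight (g u) i u := by
        rw [sdiff_union_self_eq_union]
        exact sum_le_sum_of_subset_of_nonneg subset_union_left fun u _ _ => hnn u
    _ = ∑ u ∈ F' \ U, fiberWeight (g u) i u + ∑ u ∈ U, fiberWeight (g u) i u :=
        sum_union sdiff_disjoint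
    _ ≤ _ := by
        refine add_le_add_left ?_ _
        have hFT : ∀ u ∈ F' \ U, u ∈ (i + 1).smoothNumbers ∧ T ≤ u := fun u hu => by
          obtain ⟨h1, h2⟩ := mem_sdiff.1 hu
          refine ⟨hFm u h1, ?_⟩
          by_contra! h
          exact h2 (mem_filter.2 ⟨mem_Icc.2 ⟨Nat.pos_of_ne_zero (hFm u h1).1, h.le⟩, hFm u h1⟩)
        calc ∑ u ∈ F' \ U, fiberWeight (g u) i u ≤
              ∑ u ∈ F' \ U, 1 / ((i : ℝ) * (i + 1)) * (u : ℝ)⁻¹ :=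
              sum_le_sum fun u hu => fiberWeight_le (hg.le_one u) hi (hT.trans_le (hFT u hu).2)
          _ ≤ _ := by
              rw [← mul_sum]
              exact mul_le_mul_of_nonneg_left (sum_smooth_inv_le hT h0 h1 hFT) (by positivity)

lemma abs_sum_quotFiber_sub_localDensity_le (hg : IsLocalWeight g) (n : ℕ) {T : ℕ} {δ : ℝ}
    (hi : 0 < i) (hT : 0 < T) (h0 : 0 ≤ δ) (h1 : δ ≤ 1 / 4) :
    |∑ s ∈ quotFiber n i, g s n - n * localDensity g i| ≤
      (4 * (n * (1 / (i * (i + 1))) * (T : ℝ) ^ (-δ)) + 3 * (((i + 1 : ℕ) : ℝ) * T ^ 2)) *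
        Real.exp (4 * ((i + 1 : ℕ) : ℝ) ^ δ * primeRecipSum (i + 1)) := by
  set S := primeRecipSum (i + 1) with hS
  set Q := ((i + 1 : ℕ) : ℝ) ^ δ with hQ
  set U := (Icc 1 T).filter (· ∈ (i + 1).smoothNumbers) with hU
  set V := ∏ p ∈ (i + 1).primesBelow, (1 - (p : ℝ)⁻¹) with hPi
  have hS0 : 0 ≤ S := primeRecipSum_nonneg _
  have hQ0 : 0 ≤ Q := by positivity
  have hUm : ∀ u ∈ U, u ∈ (i + 1).smoothNumbers := fun u hu => (mem_filter.1 hu).2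
  have hUT : ∀ u ∈ U, 0 < u ∧ u ≤ T := fun u hu => mem_Icc.1 (mem_filter.1 hu).1
  have hlarge : |∑ s ∈ quotFiber n i with T < smoothPart (i + 1) s, g s n| ≤
      n * (1 / (i * (i + 1))) * ((T : ℝ) ^ (-δ) * Real.exp (3 * Q * S)) +
        2 * (((i + 1 : ℕ) : ℝ) * T ^ 2) := by
    rw [abs_of_nonneg (sum_nonneg fun s _ => hg.nonneg s n)]
    refine le_trans ?_ (card_smoothPart_gt_le n hi hT h0 h1)
    rw [card_eq_sum_ones, Nat.cast_sum, Nat.cast_one]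
    exact sum_le_sum fun s _ => hg.le_one s n
  have hsmall : ∑ s ∈ quotFiber n i with ¬ T < smoothPart (i + 1) s, g s n =
      ∑ u ∈ U, ∑ v ∈ quotFiber (n / u) i with (i + 1).primesBelow.filter (· ∣ v) = ∅,
        g u (n / v) := by
    rw [← sum_fiberwise_of_maps_to (g := smoothPart (i + 1)) (t := U)]
    · refine sum_congr rfl fun u hu => ?_
      rw [← hg.sum_smoothPart_eq n hi (hUm u hu), filter_filter]
      refine sum_congr (filter_congr fun s _ => ?_) fun _ _ => rfl
      have := (hUT u hu).2
      constructor
      · exact fun h => h.2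
      · exact fun h => ⟨by omega, h⟩
    · intro s hs
      have hm := smoothPart_mem (i + 1) s
      exact mem_filter.2 ⟨mem_Icc.2 ⟨Nat.pos_of_ne_zero hm.1, not_lt.1 (mem_filter.1 hs).2⟩, hm⟩
  have hmid : |∑ s ∈ quotFiber n i with ¬ T < smoothPart (i + 1) s, g s n -
      n * (V * ∑ u ∈ U, fiberWeight (g u) i u)| ≤
      (2 * (n * (1 / (i * (i + 1))) * ((T : ℝ) ^ (-δ) * Real.exp (Q * S))) +
        ((i + 1 : ℕ) : ℝ) * T ^ 2) * Real.exp (3 * Q * S) := by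
    rw [hsmall, mul_sum, mul_sum, ← sum_sub_distrib]
    refine (abs_sum_le_sum_abs _ _).trans ?_
    refine (sum_le_sum fun u hu => abs_sum_rough_sub_le_rpow (hg.nonneg u) (hg.le_one u) n hi
      (hUT u hu).1 (hUT u hu).2 h0).trans ?_
    rw [← mul_sum]
    exact mul_le_mul_of_nonneg_left (sum_smooth_rpow_le h0 h1 hUm) (by positivity)
  have htail : |n * (V * ∑ u ∈ U, fiberWeight (g u) i u) - n * localDensity g i| ≤
      n * (1 / (i * (i + 1))) * ((T : ℝ) ^ (-δ) * Real.exp (3 * Q * S)) := by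
    rw [localDensity, ← mul_sub, ← mul_sub, abs_mul, abs_mul, Nat.abs_cast,
      abs_of_pos (prod_one_sub_inv_pos _), mul_assoc (n : ℝ)]
    refine mul_le_mul_of_nonneg_left ?_ (by positivity)
    refine (mul_le_of_le_one_left (abs_nonneg _) (prod_one_sub_inv_le_one _)).trans ?_
    exact hg.abs_tsum_sub_sum_fiberWeight_le hi hT h0 h1
  have hsplit := sum_filter_add_sum_filter_not (quotFiber n i)
    (fun s => T < smoothPart (i + 1) s) (fun s => g s n)
  have e1 : Real.exp (Q * S) * Real.exp (3 * Q * S) = Real.exp (4 * Q * S) := by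
    rw [← Real.exp_add]
    ring_nf
  have e2 : Real.exp (3 * Q * S) ≤ Real.exp (4 * Q * S) :=
    Real.exp_le_exp.2 (by nlinarith [mul_nonneg hQ0 hS0])
  have e3 : 1 ≤ Real.exp (4 * Q * S) := Real.one_le_exp (by positivity)
  set X := n * (1 / ((i : ℝ) * (i + 1))) * (T : ℝ) ^ (-δ) with hX
  set W := ((i + 1 : ℕ) : ℝ) * (T : ℝ) ^ 2 with hW
  have hX0 : 0 ≤ X := by positivity
  have hW0 : 0 ≤ W := by positivity
  have b1 : n * (1 / ((i : ℝ) * (i + 1))) * ((T : ℝ) ^ (-δ) * Real.exp (3 * Q * S)) ≤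
      X * Real.exp (4 * Q * S) := by
    rw [← mul_assoc]
    exact mul_le_mul_of_nonneg_left e2 hX0
  have b2 : (2 * (n * (1 / ((i : ℝ) * (i + 1))) * ((T : ℝ) ^ (-δ) * Real.exp (Q * S))) + W) *
      Real.exp (3 * Q * S) ≤ 2 * (X * Real.exp (4 * Q * S)) + W * Real.exp (4 * Q * S) := by
    rw [add_mul, ← e1]
    refine add_le_add (le_of_eq (by rw [hX]; ring)) ?_
    rw [e1]
    exact mul_le_mul_of_nonneg_left e2 hW0
  have b3 : W ≤ W * Real.exp (4 * Q * S) := le_mul_of_one_le_right hW0 e3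
  rw [← hsplit]
  rw [abs_le] at hlarge hmid htail ⊢
  constructor <;> linarith [hlarge.1, hlarge.2, hmid.1, hmid.2, htail.1, htail.2]

end IsLocalWeight

/-! ### Summing over the quotients -/

lemma sum_Icc_eq_sum_quotFiber (f : ℕ → ℝ) (n Y : ℕ) :
    ∑ s ∈ Icc 1 n, f s =
      ∑ s ∈ Icc 1 (n / (Y + 1)), f s + ∑ i ∈ range Y, ∑ s ∈ quotFiber n (i + 1), f s := by
  induction Y with
  | zero => simp
  | succ Y ih =>
    have hle : n / (Y + 1 + 1) ≤ n / (Y + 1) := Nat.div_le_div_left (by omega) (by omega)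
    have hset : Icc 1 (n / (Y + 1)) = Icc 1 (n / (Y + 1 + 1)) ∪ quotFiber n (Y + 1) := by
      ext s
      simp only [quotFiber, mem_union, mem_Icc, mem_Ioc]
      generalize n / (Y + 1) = a at *
      generalize n / (Y + 1 + 1) = b at *
      omega
    have hdisj : Disjoint (Icc 1 (n / (Y + 1 + 1))) (quotFiber n (Y + 1)) := by
      rw [disjoint_left]
      intro s hs hs'
      simp only [quotFiber, mem_Icc, mem_Ioc] at hs hs'
      omega
    rw [ih, sum_range_succ, hset, sum_union hdisj]
    ring

lemma sum_range_one_div_mul_succ (Y m : ℕ) :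
    ∑ i ∈ range m, 1 / (((i + Y + 1 : ℕ) : ℝ) * ((i + Y + 1 : ℕ) + 1)) =
      1 / ((Y : ℝ) + 1) - 1 / ((m : ℝ) + Y + 1) := by
  induction m with
  | zero => simp
  | succ m ih =>
    rw [sum_range_succ, ih]
    push_cast
    field_simp
    ring

namespace IsLocalWeight

variable {g : ℕ → ℕ → ℝ}

lemma sum_range_localDensity_le (hg : IsLocalWeight g) (Y m : ℕ) :
    ∑ i ∈ range m, localDensity g (i + Y + 1) ≤ 1 / ((Y : ℝ) + 1) := by
  calc _ ≤ ∑ i ∈ range m, 1 / (((i + Y + 1 : ℕ) : ℝ) * ((i + Y + 1 : ℕ) + 1)) :=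
        sum_le_sum fun i _ => hg.localDensity_le (Nat.succ_pos _)
    _ ≤ _ := by
        rw [sum_range_one_div_mul_succ]
        exact sub_le_self _ (by positivity)

lemma summable_localDensity (hg : IsLocalWeight g) :
    Summable fun i => localDensity g (i + 1) :=
  summable_of_sum_range_le (fun _ => hg.localDensity_nonneg _)
    (hg.sum_range_localDensity_le 0)

lemma abs_sum_sub_le (hg : IsLocalWeight g) (n Y : ℕ) :
    |∑ s ∈ Icc 1 n, g s n - n * ∑' i, localDensity g (i + 1)| ≤
      ∑ i ∈ range Y, |∑ s ∈ quotFiber n (i + 1), g s n - n * localDensity g (i + 1)| +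
        2 * (n / ((Y : ℝ) + 1)) := by
  have h1 : 0 ≤ ∑ s ∈ Icc 1 (n / (Y + 1)), g s n := sum_nonneg fun s _ => hg.nonneg s n
  have h2 : ∑ s ∈ Icc 1 (n / (Y + 1)), g s n ≤ n / ((Y : ℝ) + 1) := by
    calc _ ≤ ∑ s ∈ Icc 1 (n / (Y + 1)), (1 : ℝ) := sum_le_sum fun s _ => hg.le_one s n
      _ = ((n / (Y + 1) : ℕ) : ℝ) := by simp
      _ ≤ _ := by exact_mod_cast Nat.cast_div_le (α := ℝ) (m := n) (n := Y + 1)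
  have h3 : 0 ≤ ∑' i, localDensity g (i + Y + 1) := tsum_nonneg fun i => hg.localDensity_nonneg _
  have h4 : n * ∑' i, localDensity g (i + Y + 1) ≤ n / ((Y : ℝ) + 1) := by
    rw [div_eq_mul_one_div]
    exact mul_le_mul_of_nonneg_left (Real.tsum_le_of_sum_range_le
      (fun i => hg.localDensity_nonneg _) (hg.sum_range_localDensity_le Y)) (by positivity)
  have h5 : 0 ≤ n * ∑' i, localDensity g (i + Y + 1) := mul_nonneg (by positivity) h3
  have h6 := abs_sum_le_sum_abs
    (fun i => ∑ s ∈ quotFiber n (i + 1), g s n - n * localDensity g (i + 1)) (range Y)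
  rw [sum_sub_distrib, ← mul_sum] at h6
  rw [sum_Icc_eq_sum_quotFiber _ n Y, ← hg.summable_localDensity.sum_add_tsum_nat_add Y, mul_add]
  rw [abs_le] at h6 ⊢
  constructor <;> linarith [h6.1, h6.2]

end IsLocalWeight

/-! ### Reciprocals of primes -/

lemma primeRecipSum_mono {a b : ℕ} (h : a ≤ b) : primeRecipSum a ≤ primeRecipSum b :=
  sum_le_sum_of_subset_of_nonneg (fun p hp => Nat.mem_primesBelow.2
    ⟨(Nat.lt_of_mem_primesBelow hp).trans_le h, Nat.prime_of_mem_primesBelow hp⟩)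
    fun p _ _ => by positivity

lemma primeRecipSum_two_pow_succ_le {m : ℕ} (hm : 0 < m) :
    primeRecipSum (2 ^ (m + 1)) ≤ primeRecipSum (2 ^ m) + 4 * (m : ℝ)⁻¹ := by
  set B := (2 ^ (m + 1)).primesBelow.filter (2 ^ m ≤ ·) with hB
  have hset : (2 ^ (m + 1)).primesBelow = (2 ^ m).primesBelow ∪ B := by
    ext p
    have : 2 ^ m < 2 ^ (m + 1) := Nat.pow_lt_pow_right (by norm_num) (by omega)
    simp only [hB, mem_union, mem_filter, Nat.mem_primesBelow]
    by_cases hp : p.Prime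
    · simp only [hp, and_true]
      omega
    · simp [hp]
  have hdisj : Disjoint (2 ^ m).primesBelow B := by
    rw [disjoint_left]
    intro p hp hp'
    have := Nat.lt_of_mem_primesBelow hp
    have := (mem_filter.1 hp').2
    omega
  rw [primeRecipSum, hset, sum_union hdisj]
  refine add_le_add le_rfl ?_
  have hcard : m * #B ≤ 2 ^ (m + 2) := by
    have h1 : (2 ^ m) ^ #B ≤ ∏ p ∈ B, p :=
      pow_card_le_prod _ _ _ fun p hp => (mem_filter.1 hp).2
    have h2 : ∏ p ∈ B, p ≤ primorial (2 ^ (m + 1)) := by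
      rw [primorial]
      refine prod_le_prod_of_subset_of_one_le' (fun p hp => ?_) fun p hp _ =>
        (mem_filter.1 hp).2.one_le
      have := Nat.mem_primesBelow.1 (mem_filter.1 hp).1
      exact mem_filter.2 ⟨mem_range.2 (by omega), this.2⟩
    have h3 : (2 ^ m) ^ #B ≤ 2 ^ 2 ^ (m + 2) := by
      calc _ ≤ 4 ^ 2 ^ (m + 1) := (h1.trans h2).trans (primorial_le_four_pow _)
        _ = _ := by
          rw [show (4 : ℕ) = 2 ^ 2 by norm_num, ← pow_mul]
          ring_nf
    rw [← pow_mul] at h3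
    exact (Nat.pow_le_pow_iff_right (by norm_num)).1 h3
  have hm' : (0 : ℝ) < m := by exact_mod_cast hm
  have hcard' : (m : ℝ) * #B ≤ 4 * 2 ^ m := by
    calc (m : ℝ) * #B ≤ 2 ^ (m + 2) := by exact_mod_cast hcard
      _ = _ := by ring
  calc ∑ p ∈ B, (p : ℝ)⁻¹ ≤ ∑ p ∈ B, ((2 : ℝ) ^ m)⁻¹ := by
        refine sum_le_sum fun p hp => inv_anti₀ (by positivity) ?_
        exact_mod_cast (mem_filter.1 hp).2
    _ = #B * ((2 : ℝ) ^ m)⁻¹ := by rw [sum_const, nsmul_eq_mul]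
    _ ≤ _ := by
        rw [← div_eq_mul_inv, ← div_eq_mul_inv, div_le_div_iff₀ (by positivity) hm']
        linarith

lemma primeRecipSum_two_pow_succ_le_log (m : ℕ) :
    primeRecipSum (2 ^ (m + 1)) ≤ 4 * (1 + Real.log m) := by
  have h : primeRecipSum (2 ^ (m + 1)) ≤ 4 * (harmonic m : ℝ) := by
    induction m with
    | zero =>
      have : Nat.primesBelow 2 = ∅ := by decide
      simp [primeRecipSum, this]
    | succ m ih =>
      have := primeRecipSum_two_pow_succ_le (Nat.succ_pos m)
      rw [harmonic_succ]
      push_cast at this ⊢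
      linarith
  exact h.trans (mul_le_mul_of_nonneg_left (harmonic_le_one_add_log m) (by norm_num))

lemma primeRecipSum_le {q : ℕ} (hq : 2 ≤ q) :
    primeRecipSum q ≤ 4 * (1 + Real.log (2 * Real.log q)) := by
  set m := Nat.log 2 q with hm
  have hm0 : 0 < m := Nat.log_pos (by norm_num) hq
  have hq0 : (0 : ℝ) < q := by positivity
  have h1 : (m : ℝ) ≤ 2 * Real.log q := by
    have h2 : (2 : ℝ) ^ m ≤ q := by exact_mod_cast Nat.pow_log_le_self 2 (by omega : q ≠ 0)
    have h3 := Real.log_le_log (by positivity) h2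
    rw [Real.log_pow] at h3
    nlinarith [Real.log_two_gt_d9]
  calc primeRecipSum q ≤ primeRecipSum (2 ^ (m + 1)) :=
        primeRecipSum_mono (Nat.lt_pow_succ_log_self (by norm_num) q).le
    _ ≤ 4 * (1 + Real.log m) := primeRecipSum_two_pow_succ_le_log m
    _ ≤ _ := by
        have : (0 : ℝ) < m := by exact_mod_cast hm0
        have := Real.log_le_log this h1
        linarith

/-! ### Optimizing the parameters -/

/-- The exponent `min (1/4) (log Z / log q)`, for which `q ^ δ ≤ Z`. -/
noncomputable def rankinExponent (Z q : ℝ) : ℝ := min (1 / 4) (Real.log Z / Real.log q)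

lemma rpow_rankinExponent_le {Z q : ℝ} (hZ : 1 ≤ Z) (hq : 1 < q) :
    q ^ rankinExponent Z q ≤ Z := by
  calc q ^ rankinExponent Z q ≤ q ^ (Real.log Z / Real.log q) :=
        Real.rpow_le_rpow_of_exponent_le hq.le (min_le_right _ _)
    _ = Z := by
        rw [Real.rpow_def_of_pos (by linarith), mul_div_cancel₀ _ (Real.log_pos hq).ne',
          Real.exp_log (by linarith)]

lemma rankinExponent_nonneg {Z q : ℝ} (hZ : 1 ≤ Z) (hq : 1 < q) : 0 ≤ rankinExponent Z q :=
  le_min (by norm_num) (div_nonneg (Real.log_nonneg hZ) (Real.log_pos hq).le)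

lemma le_log_add_mul_rankinExponent {x η q L : ℝ} (hη0 : 0 < η) (hη : η ≤ 1 / 4) (hq : 1 < q)
    (hL0 : 0 ≤ L) (hxL : 16 * L ≤ x) (hL : L ^ 2 = x * Real.log x) :
    (1 - 2 * η) * L ≤
      Real.log q + rankinExponent (Real.exp ((1 / 2 - η) * Real.log x)) q * (x * (1 - η) / 2) := by
  have ha : 0 < Real.log q := Real.log_pos hq
  rw [rankinExponent, Real.log_exp]
  rcases min_cases (1 / 4 : ℝ) ((1 / 2 - η) * Real.log x / Real.log q) with h | h
  · rw [h.1]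
    nlinarith
  · rw [h.1]
    set a := Real.log q
    have e : (1 / 2 - η) * Real.log x / a * (x * (1 - η) / 2) =
        (1 - 2 * η) * (1 - η) / 4 * L ^ 2 / a := by
      rw [hL]
      ring
    rw [e, ← sub_le_iff_le_add', le_div_iff₀ ha]
    have h1 : (1 - 2 * η) ^ 2 / 4 * L ^ 2 ≤ (1 - 2 * η) * (1 - η) / 4 * L ^ 2 := by
      refine mul_le_mul_of_nonneg_right ?_ (sq_nonneg L)
      nlinarith
    nlinarith [sq_nonneg (a - (1 - 2 * η) * L / 2)]

lemma floor_exp_rpow_neg_le {y δ : ℝ} (hy : 0 ≤ y) (h0 : 0 ≤ δ) (h1 : δ ≤ 1 / 4) :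
    (⌊Real.exp y⌋₊ : ℝ) ^ (-δ) ≤ 2 * Real.exp (-(δ * y)) := by
  have hR : 1 ≤ Real.exp y := Real.one_le_exp hy
  have hT1 : (1 : ℝ) ≤ ⌊Real.exp y⌋₊ := by exact_mod_cast Nat.floor_pos.2 hR
  have hT2 := Nat.lt_floor_add_one (Real.exp y)
  calc (⌊Real.exp y⌋₊ : ℝ) ^ (-δ) ≤ (Real.exp y / 2) ^ (-δ) :=
        Real.rpow_le_rpow_of_nonpos (by positivity) (by linarith) (by linarith)
    _ = 2 ^ δ * Real.exp (-(δ * y)) := by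
        rw [Real.div_rpow (by positivity) (by norm_num), ← Real.exp_mul,
          Real.rpow_neg (by norm_num : (0 : ℝ) ≤ 2), div_inv_eq_mul, mul_comm]
        congr 2
        ring
    _ ≤ _ := by
        refine mul_le_mul_of_nonneg_right ?_ (by positivity)
        calc (2 : ℝ) ^ δ ≤ 2 ^ (1 : ℝ) :=
              Real.rpow_le_rpow_of_exponent_le (by norm_num) (by linarith)
          _ = 2 := Real.rpow_one 2

lemma IsLocalWeight.abs_sum_sub_le_exp {g : ℕ → ℕ → ℝ} (hg : IsLocalWeight g) {n : ℕ}
    {η x L : ℝ} (hη0 : 0 < η) (hη : η ≤ 1 / 4) (hn : n = Real.exp x) (hx : 1 ≤ Real.log x)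
    (hL0 : 1 ≤ L) (hL : L ^ 2 = x * Real.log x) (hLx : 4 * L ≤ η * x)
    (hLexp : 1 + L ≤ Real.exp (η * L))
    (hZ : 48 * Real.exp ((1 / 2 - η) * Real.log x) * Real.log x ≤ η * L) :
    |∑ s ∈ Icc 1 n, g s n - n * ∑' i, localDensity g (i + 1)| ≤
      22 * (n * Real.exp (-((1 - 4 * η) * L))) := by
  set Z := Real.exp ((1 / 2 - η) * Real.log x) with hZdef
  set Y := ⌊Real.exp L⌋₊ with hY
  set y := x * (1 - η) / 2 with hy
  set T := ⌊Real.exp y⌋₊ with hT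
  have hxL : 16 * L ≤ x := by nlinarith
  have hx0 : 0 < x := by linarith
  have hy0 : 0 ≤ y := by
    have : 0 ≤ 1 - η := by linarith
    positivity
  have hZ1 : 1 ≤ Z := Real.one_le_exp (mul_nonneg (by linarith) (by linarith))
  have hT0 : 0 < T := Nat.floor_pos.2 (Real.one_le_exp hy0)
  have hTsq : (T : ℝ) ^ 2 ≤ Real.exp (x - η * x) := by
    calc (T : ℝ) ^ 2 ≤ Real.exp y ^ 2 := by
          gcongr
          exact Nat.floor_le (by positivity)
      _ = _ := by
          rw [← Real.exp_nat_mul]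
          congr 1
          rw [hy]
          push_cast
          ring
  have hYle : (Y : ℝ) ≤ Real.exp L := Nat.floor_le (by positivity)
  have hYlt : Real.exp L < Y + 1 := Nat.lt_floor_add_one _
  have hexpL : 1 ≤ Real.exp L := Real.one_le_exp (by linarith)
  have hY2 : (Y : ℝ) + 1 ≤ 2 * Real.exp L := by linarith
  have hlogq : Real.log (2 * Real.exp L) ≤ x := by
    rw [Real.log_mul (by norm_num) (by positivity), Real.log_exp]
    linarith [Real.log_two_lt_d9]
  set E := Real.exp (η * L) with hE
  have hE0 : 0 < E := Real.exp_pos _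
  have hterm : ∀ i ∈ range Y,
      |∑ s ∈ quotFiber n (i + 1), g s n - n * localDensity g (i + 1)| ≤
        8 * (n * Real.exp (-((1 - 2 * η) * L)) * E) * ((i + 1 : ℕ) : ℝ)⁻¹ +
          6 * (Real.exp L * Real.exp (x - η * x) * E) := by
    intro i hi
    set q : ℝ := ((i + 1 + 1 : ℕ) : ℝ) with hq
    set δ := rankinExponent Z q with hδ
    have hq1 : 1 < q := by
      rw [hq]
      exact_mod_cast (by omega : 1 < i + 1 + 1)
    have hq2 : q ≤ 2 * Real.exp L := by
      refine le_trans ?_ hY2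
      rw [hq]
      exact_mod_cast (by have := mem_range.1 hi; omega : i + 1 + 1 ≤ Y + 1)
    have hδ0 : 0 ≤ δ := rankinExponent_nonneg hZ1 hq1
    have hδ1 : δ ≤ 1 / 4 := min_le_left _ _
    have hexp : Real.exp (4 * q ^ δ * primeRecipSum (i + 1 + 1)) ≤ E := by
      refine Real.exp_le_exp.2 ?_
      have hS0 := primeRecipSum_nonneg (i + 1 + 1)
      have hS : primeRecipSum (i + 1 + 1) ≤ 12 * Real.log x := by
        refine (primeRecipSum_le (by omega)).trans ?_
        have h1 : Real.log q ≤ x := (Real.log_le_log (by linarith) hq2).trans hlogq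
        have h2 : Real.log (2 * Real.log q) ≤ Real.log (2 * x) :=
          Real.log_le_log (mul_pos two_pos (Real.log_pos hq1)) (by linarith)
        rw [Real.log_mul (by norm_num) hx0.ne'] at h2
        linarith [Real.log_two_lt_d9]
      calc 4 * q ^ δ * primeRecipSum (i + 1 + 1) ≤ 4 * Z * (12 * Real.log x) :=
            mul_le_mul (mul_le_mul_of_nonneg_left (rpow_rankinExponent_le hZ1 hq1) (by norm_num))
              hS hS0 (by positivity)
        _ = 48 * Z * Real.log x := by ring
        _ ≤ _ := hZ
    have hdecay : q⁻¹ * (T : ℝ) ^ (-δ) ≤ 2 * Real.exp (-((1 - 2 * η) * L)) := by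
      have h1 : (1 - 2 * η) * L ≤ Real.log q + δ * y :=
        le_log_add_mul_rankinExponent hη0 hη hq1 (by linarith) hxL hL
      calc q⁻¹ * (T : ℝ) ^ (-δ) ≤ q⁻¹ * (2 * Real.exp (-(δ * y))) :=
            mul_le_mul_of_nonneg_left (floor_exp_rpow_neg_le hy0 hδ0 hδ1) (by positivity)
        _ = 2 * Real.exp (-(Real.log q + δ * y)) := by
            rw [neg_add, Real.exp_add, Real.exp_neg (Real.log q), Real.exp_log (by linarith)]
            ring
        _ ≤ _ := by
            refine mul_le_mul_of_nonneg_left (Real.exp_le_exp.2 ?_) (by norm_num)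
            linarith
    have hqi : ((i + 1 : ℕ) : ℝ) + 1 = q := by
      rw [hq]
      push_cast
      ring
    refine (hg.abs_sum_quotFiber_sub_localDensity_le n (Nat.succ_pos i) hT0 hδ0 hδ1).trans ?_
    rw [← hq, hqi]
    calc _ ≤ (4 * (n * (((i + 1 : ℕ) : ℝ)⁻¹ * (2 * Real.exp (-((1 - 2 * η) * L))))) +
          3 * (2 * Real.exp L * Real.exp (x - η * x))) * E := by
          refine mul_le_mul (add_le_add ?_ ?_) hexp (by positivity) (by positivity)
          · rw [one_div, mul_inv, mul_assoc (n : ℝ), mul_assoc]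
            gcongr
          · gcongr
      _ = _ := by ring
  have hharm : ∑ i ∈ range Y, ((i + 1 : ℕ) : ℝ)⁻¹ ≤ E := by
    have h1 : ∑ i ∈ range Y, ((i + 1 : ℕ) : ℝ)⁻¹ = (harmonic Y : ℝ) := by
      rw [harmonic]
      push_cast
      rfl
    have h2 : Real.log Y ≤ L := by
      rw [← Real.log_exp L]
      refine Real.log_le_log ?_ hYle
      exact_mod_cast Nat.floor_pos.2 hexpL
    rw [h1]
    linarith [harmonic_le_one_add_log Y]
  have hfirst : n * Real.exp (-((1 - 2 * η) * L)) * E * E =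
      n * Real.exp (-((1 - 4 * η) * L)) := by
    rw [hE, mul_assoc, mul_assoc, ← Real.exp_add, ← Real.exp_add]
    ring_nf
  have hsecond : Y * (Real.exp L * Real.exp (x - η * x) * E) ≤
      n * Real.exp (-((1 - 4 * η) * L)) := by
    calc _ ≤ Real.exp L * (Real.exp L * Real.exp (x - η * x) * E) := by gcongr
      _ ≤ _ := by
        rw [hn, hE, ← Real.exp_add, ← Real.exp_add, ← Real.exp_add, ← Real.exp_add]
        refine Real.exp_le_exp.2 ?_
        nlinarith
  have hthird : n / ((Y : ℝ) + 1) ≤ n * Real.exp (-((1 - 4 * η) * L)) := by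
    rw [div_eq_mul_inv]
    refine mul_le_mul_of_nonneg_left ?_ (by positivity)
    calc ((Y : ℝ) + 1)⁻¹ ≤ (Real.exp L)⁻¹ := inv_anti₀ (by positivity) hYlt.le
      _ = Real.exp (-L) := (Real.exp_neg L).symm
      _ ≤ _ := Real.exp_le_exp.2 (by nlinarith)
  refine (hg.abs_sum_sub_le n Y).trans ?_
  calc _ ≤ 8 * (n * Real.exp (-((1 - 2 * η) * L)) * E) * ∑ i ∈ range Y, ((i + 1 : ℕ) : ℝ)⁻¹ +
        6 * (Y * (Real.exp L * Real.exp (x - η * x) * E)) + 2 * (n / ((Y : ℝ) + 1)) := by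
        refine add_le_add ((sum_le_sum hterm).trans (le_of_eq ?_)) le_rfl
        rw [sum_add_distrib, ← mul_sum, sum_const, card_range, nsmul_eq_mul]
        ring
    _ ≤ 8 * (n * Real.exp (-((1 - 2 * η) * L)) * E) * E +
        6 * (n * Real.exp (-((1 - 4 * η) * L))) + 2 * (n * Real.exp (-((1 - 4 * η) * L))) := by
        gcongr
    _ = 14 * (n * Real.exp (-((1 - 4 * η) * L))) +
        2 * (n * Real.exp (-((1 - 4 * η) * L))) := by
        rw [mul_assoc 8, hfirst]
        ring
    _ ≤ _ := by
        have : 0 ≤ n * Real.exp (-((1 - 4 * η) * L)) := by positivity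
        linarith

/-! ### The asymptotic formula -/

open Filter in
lemma eventually_parameter_bounds {η : ℝ} (hη0 : 0 < η) (hη : η ≤ 1 / 4) :
    ∀ᶠ x : ℝ in atTop, 1 ≤ Real.log x ∧ 1 ≤ √(x * Real.log x) ∧
      4 * √(x * Real.log x) ≤ η * x ∧
      1 + √(x * Real.log x) ≤ Real.exp (η * √(x * Real.log x)) ∧
      48 * Real.exp ((1 / 2 - η) * Real.log x) * Real.log x ≤ η * √(x * Real.log x) := by
  have h1 := (isLittleO_log_rpow_atTop (show (0 : ℝ) < 2 * η by linarith)).bound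
    (show (0 : ℝ) < (η / 48) ^ 2 by positivity)
  have h2 := Real.isLittleO_log_id_atTop.bound (show (0 : ℝ) < (η / 4) ^ 2 by positivity)
  filter_upwards [h1, h2, Real.tendsto_log_atTop.eventually_ge_atTop 1,
    eventually_ge_atTop ((2 / η ^ 2) ^ 2), eventually_ge_atTop 1] with x h1 h2 hl hx hx1
  have hx0 : 0 < x := by linarith
  set l := Real.log x with hldef
  have hl0 : 0 ≤ l := by linarith
  rw [Real.norm_of_nonneg hl0, Real.norm_of_nonneg (by positivity)] at h1
  rw [Real.norm_of_nonneg hl0, id, Real.norm_of_nonneg hx0.le] at h2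
  set L := √(x * l) with hLdef
  have hL1 : 2 / η ^ 2 ≤ L := by
    refine Real.le_sqrt_of_sq_le ?_
    nlinarith
  have hL2 : 1 ≤ L := by
    refine Real.le_sqrt_of_sq_le ?_
    nlinarith
  refine ⟨hl, hL2, ?_, ?_, ?_⟩
  · have : L ≤ η / 4 * x := by
      refine Real.sqrt_le_iff.2 ⟨by positivity, ?_⟩
      nlinarith
    linarith
  · have h3 := Real.quadratic_le_exp_of_nonneg (show 0 ≤ η * L by positivity)
    rw [div_le_iff₀ (by positivity)] at hL1
    nlinarith
  · have h3 : √l ≤ η / 48 * x ^ η := by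
      refine Real.sqrt_le_iff.2 ⟨by positivity, ?_⟩
      rwa [mul_pow, ← Real.rpow_mul_natCast hx0.le, mul_comm η, Nat.cast_ofNat]
    have h4 : Real.exp ((1 / 2 - η) * l) * x ^ η = √x := by
      rw [Real.rpow_def_of_pos hx0, ← Real.exp_add, Real.sqrt_eq_rpow, Real.rpow_def_of_pos hx0]
      congr 1
      rw [← hldef]
      ring
    calc 48 * Real.exp ((1 / 2 - η) * l) * l
        = 48 * Real.exp ((1 / 2 - η) * l) * √l * √l := by
          rw [mul_assoc _ (√l), Real.mul_self_sqrt hl0]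
      _ ≤ 48 * Real.exp ((1 / 2 - η) * l) * (η / 48 * x ^ η) * √l := by gcongr
      _ = η * ((Real.exp ((1 / 2 - η) * l) * x ^ η) * √l) := by ring
      _ = η * L := by rw [h4, hLdef, Real.sqrt_mul hx0.le]

open Filter in
theorem IsLocalWeight.eventually_abs_sum_sub_le {g : ℕ → ℕ → ℝ} (hg : IsLocalWeight g) {ε : ℝ}
    (hε : 0 < ε) :
    ∀ᶠ n : ℕ in atTop, |∑ s ∈ Icc 1 n, g s n - n * ∑' i, localDensity g (i + 1)| ≤
      22 * (n * Real.exp (-(1 - ε) * √(Real.log n * Real.log (Real.log n)))) := by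
  set η := min ε 1 / 4 with hη
  have hη0 : 0 < η := div_pos (lt_min hε one_pos) (by norm_num)
  have hη1 : η ≤ 1 / 4 := div_le_div_of_nonneg_right (min_le_right _ _) (by norm_num)
  have hηε : 4 * η ≤ ε := by
    rw [hη]
    linarith [min_le_left ε 1]
  filter_upwards [(Real.tendsto_log_atTop.comp tendsto_natCast_atTop_atTop).eventually
    (eventually_parameter_bounds hη0 hη1), eventually_ge_atTop 1] with n hn hn1
  obtain ⟨h1, h2, h3, h4, h5⟩ := hn
  have hn0 : (0 : ℝ) < n := by exact_mod_cast hn1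
  have hsq : √(Real.log n * Real.log (Real.log n)) ^ 2 = Real.log n * Real.log (Real.log n) :=
    Real.sq_sqrt (by
      by_contra! h
      have := Real.sqrt_eq_zero_of_nonpos h.le
      simp only [Function.comp_apply, this] at h2
      linarith)
  refine (hg.abs_sum_sub_le_exp hη0 hη1 (Real.exp_log hn0).symm h1 h2 hsq h3 h4 h5).trans ?_
  gcongr
  rw [← neg_mul]
  exact mul_le_mul_of_nonneg_right (by linarith) (Real.sqrt_nonneg _)

lemma exists_forall_abs_le_mul_of_eventually {F B : ℕ → ℝ} {C : ℝ} {a : ℕ}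
    (hB : ∀ n, a ≤ n → 0 < B n) (hC : 0 ≤ C) (h : ∀ᶠ n in Filter.atTop, |F n| ≤ C * B n) :
    ∃ K : ℝ, ∀ n, a ≤ n → |F n| ≤ K * B n := by
  obtain ⟨N, hN⟩ := Filter.eventually_atTop.1 h
  have hnn : ∀ n ∈ Ico a N, 0 ≤ |F n| / B n := fun n hn =>
    div_nonneg (abs_nonneg _) (hB n (mem_Ico.1 hn).1).le
  refine ⟨C + ∑ n ∈ Ico a N, |F n| / B n, fun n hn => ?_⟩
  rcases le_or_gt N n with hNn | hNn
  · exact (hN n hNn).trans (mul_le_mul_of_nonneg_right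
      (le_add_of_nonneg_right (sum_nonneg hnn)) (hB n hn).le)
  · rw [← div_le_iff₀ (hB n hn)]
    exact (single_le_sum hnn (mem_Ico.2 ⟨hn, hNn⟩)).trans (le_add_of_nonneg_left hC)

lemma isLocalWeight_forkInc (r : ℕ) : IsLocalWeight (forkInc r) :=
  ⟨forkInc_nonneg r, forkInc_le_one r, forkInc_mul r⟩

/-- For every `r ≥ 2` there is a real constant `c_r` with
`f_r(n) = c_r·n + O_ε(n · exp(−(1−ε)√(log n · log log n)))`. -/
theorem rFork_density (r : ℕ) (hr : 2 ≤ r) :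
    ∃ c : ℝ, ∀ ε : ℝ, 0 < ε → ∃ K : ℝ, ∀ n : ℕ, 3 ≤ n →
      |(fFork r n : ℝ) - c * n| ≤
        K * n * Real.exp (-(1 - ε) * Real.sqrt (Real.log n * Real.log (Real.log n))) := by
  refine ⟨∑' i, localDensity (forkInc r) (i + 1), fun ε hε => ?_⟩
  simp_rw [mul_assoc]
  refine exists_forall_abs_le_mul_of_eventually (fun n hn => ?_) (by norm_num : (0 : ℝ) ≤ 22) ?_
  · have : (0 : ℝ) < n := by exact_mod_cast (by omega : 0 < n)
    positivity
  · filter_upwards [(isLocalWeight_forkInc r).eventually_abs_sum_sub_le hε] with n hn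
    rwa [fFork_eq_sum_forkInc, mul_comm (∑' i, localDensity (forkInc r) (i + 1))]
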